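/- Let F_q be a finite field with q elements. For every ε > 0 there exists δ > 0 such that for all sufficiently large q and all sets A, B, C, D ⊆ F_q with |A| ≥ q^{1/2+ε}, |B| ≥ q^ε, and |C||D| ≥ q^{2-δ}, the number T(A,B,C,D) of solutions of a + b = cd with (a,b,c,d) ∈ A×B×C×D satisfies T(A,B,C,D) = (|A||B||C||D|/q)·(1 + O(q^{-δ})). -/

import Mathlib

open Finset

set_option maxHeartbeats 4000000 in
open Polynomial in
theorem stepanov_count {K : Type} [Field K] [Fintype K] [DecidableEq K] (p k Q d M : ℕ)
    [Fact p.Prime] [CharP K p] (hQ : Q = p ^ k) (hK : Fintype.card K = Q ^ 2) (hd : 2 ≤ d)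
    (hdvd : d ∣ Q ^ 2 - 1) (f : K[X]) (hf : f.Monic) (hM : f.natDegree = M)
    (hcop : M.Coprime d) (hQ0 : 2 * d * (M + 2) ≤ Q) (a : K) :
    d * (univ.filter (fun x : K => f.eval x ^ ((Q ^ 2 - 1) / d) = a)).card
      ≤ Q ^ 2 + d * Q * (4 * M + 4) := by
  classical
  have hd0 : 0 < d := by omega
  have hQpos : 0 < Q := by
    have : 0 < 2 * d * (M + 2) := by positivity
    omega
  obtain ⟨c, hc⟩ := hdvd
  have hcd : (Q ^ 2 - 1) / d = c := by rw [hc]; exact Nat.mul_div_cancel_left _ hd0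
  have hQ2 : Q ^ 2 = d * c + 1 := by
    have : 0 < Q ^ 2 := by positivity
    omega
  rw [hcd]
  set I : ℕ := Q / d - (M + 1) with hI
  set J : ℕ := Q / d + (2 * M + 3) with hJ
  let τ : ℕ → ℕ := fun j => ((d - 1) * Q * j) % d
  have hτlt : ∀ j, τ j < d := fun j => Nat.mod_lt _ hd0
  have hτdvd : ∀ j, d ∣ τ j + Q * j := by
    intro j
    have h1 : (τ j + Q * j) % d = 0 := by
      simp only [τ, Nat.mod_add_mod]
      have : (d - 1) * Q * j + Q * j = d * (Q * j) := by
        obtain ⟨e, rfl⟩ : ∃ e, d = e + 1 := ⟨d - 1, by omega⟩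
        simp; ring
      rw [this]; simp
    exact Nat.dvd_of_mod_eq_zero h1
  choose u hu using hτdvd
  have hv' : ∀ j, d ∣ Q * τ j + j := by
    intro j
    have h1 : d ∣ Q * (τ j + Q * j) := ⟨Q * u j, by rw [hu]; ring⟩
    have h2 : Q * (τ j + Q * j) = (Q * τ j + j) + d * (c * j) := by
      have : Q * (τ j + Q * j) = Q * τ j + Q ^ 2 * j := by ring
      rw [this, hQ2]; ring
    rw [h2] at h1
    exact (Nat.dvd_add_left ⟨c * j, rfl⟩).mp h1
  choose v hv using hv'
  have huv : ∀ j, Q * u j = v j + c * j := by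
    intro j
    have : d * (Q * u j) = d * (v j + c * j) := by
      calc d * (Q * u j) = Q * (d * u j) := by ring
        _ = Q * τ j + Q ^ 2 * j := by rw [← hu]; ring
        _ = (Q * τ j + j) + d * (c * j) := by rw [hQ2]; ring
        _ = _ := by rw [hv]; ring
    exact Nat.eq_of_mul_eq_mul_left hd0 this
  let ι := Fin I × Fin J × Fin d
  -- size facts
  have hQd1 : d * (Q / d) ≤ Q := Nat.mul_div_le Q d
  have hQd2 : Q < d * (Q / d) + d := by
    have := Nat.lt_mul_div_succ Q hd0
    nlinarith
  have hQdM : 2 * (M + 2) ≤ Q / d := by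
    rw [Nat.le_div_iff_mul_le hd0]; nlinarith
  have hIeq : I + (M + 1) = Q / d := by omega
  have hdI : d * I + d * (M + 1) = d * (Q / d) := by rw [← hIeq]; ring
  set N : ℕ := Q * I + J + M * (Q + 1) - Q with hN
  have hvle : ∀ j : Fin d, M * v j ≤ M * (Q + 1) := by
    intro j
    apply Nat.mul_le_mul_left
    have h1 := hv j
    have h2 := hτlt j
    have h3 := j.2
    have : d * v j ≤ d * (Q + 1) := by
      rw [← h1]; nlinarith
    exact Nat.le_of_mul_le_mul_left this hd0
  have hule : ∀ j : Fin d, M * u j ≤ M * (Q + 1) := by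
    intro j
    apply Nat.mul_le_mul_left
    have h1 := hu j
    have h2 := hτlt j
    have h3 := j.2
    have : d * u j ≤ d * (Q + 1) := by
      rw [← h1]; nlinarith
    exact Nat.le_of_mul_le_mul_left this hd0
  let g : ι → K[X] := fun i => C (a ^ (i.2.2 : ℕ)) * (X ^ (Q * i.1 + i.2.1 : ℕ) * f ^ v i.2.2)
  have hgdeg : ∀ i, (g i).natDegree < N := by
    intro i
    have h1 : (g i).natDegree ≤ Q * i.1 + i.2.1 + M * v i.2.2 := by
      refine (natDegree_C_mul_le _ _).trans ?_
      refine natDegree_mul_le.trans ?_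
      have := natDegree_pow_le (p := f) (n := v i.2.2)
      rw [natDegree_X_pow]; rw [hM] at this; nlinarith
    have h2 := hvle i.2.2
    have h3 : Q * (i.1 : ℕ) + Q ≤ Q * I := by
      have := i.1.2; nlinarith
    have h4 := i.2.1.2
    omega
  -- kernel
  let Φ : (ι → K) →ₗ[K] (Fin N → K) :=
    LinearMap.pi (fun n => ∑ i : ι, (g i).coeff n • LinearMap.proj i)
  have hcard : N < Fintype.card ι := by
    simp only [ι, Fintype.card_prod, Fintype.card_fin]
    have e1 : 2 * (d * I) ≥ Q := by nlinarith
    have e2 : I * (J * d) = I * (d * (Q/d)) + I * d * (2 * M + 3) := by rw [hJ]; ring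
    have e3 : I * (d * (Q / d)) + I * d ≥ I * Q := by nlinarith
    have e4 : I * d * (2 * M + 3) = d * I * (2 * M + 2) + I * d := by ring
    have e5 : d * I * (2 * M + 2) ≥ Q * (M + 1) := by nlinarith
    have e6 : Q / d ≤ Q := Nat.div_le_self _ _
    have e7 : Q * (M + 1) = Q * M + Q := by ring
    have e8 : 4 * (M + 2) ≤ Q := by nlinarith
    have e9 : M * (Q + 1) = Q * M + M := by ring
    have e10 : Q * I = I * Q := by ring
    omega
  have hker : LinearMap.ker Φ ≠ ⊥ := by
    apply LinearMap.ker_ne_bot_of_finrank_lt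
    simpa using hcard
  obtain ⟨Γ, hΓ, hΓ0⟩ := Submodule.exists_mem_ne_zero_of_ne_bot hker
  have hG : ∑ i : ι, C (Γ i) * g i = 0 := by
    ext n
    rw [finsetSum_coeff]
    simp only [coeff_C_mul, coeff_zero]
    by_cases hn : n < N
    · have := congrFun (LinearMap.mem_ker.mp hΓ) ⟨n, hn⟩
      simp only [Φ, LinearMap.pi_apply, LinearMap.sum_apply, LinearMap.smul_apply,
        LinearMap.proj_apply, smul_eq_mul, Pi.zero_apply] at this
      rw [← this]
      exact Finset.sum_congr rfl (fun i _ => mul_comm _ _)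
    · apply Finset.sum_eq_zero
      intro i _
      rw [coeff_eq_zero_of_natDegree_lt (lt_of_lt_of_le (hgdeg i) (not_lt.mp hn)), mul_zero]
  let t : ι → K[X] := fun i => X ^ (i.1 + Q * i.2.1 : ℕ) * f ^ u i.2.2
  have htmonic : ∀ i, (t i).Monic := fun i => (monic_X_pow _).mul (hf.pow _)
  have htdeg : ∀ i, (t i).natDegree = i.1 + Q * i.2.1 + M * u i.2.2 := by
    intro i
    rw [(monic_X_pow _).natDegree_mul (hf.pow _), natDegree_X_pow, hf.natDegree_pow, hM]
    ring
  have htinj : Function.Injective (fun i => (t i).natDegree) := by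
    intro i i' h
    simp only [htdeg] at h
    have hw : ∀ i : ι, d * ((i.1 : ℕ) + Q * i.2.1 + M * u i.2.2)
        = (d * i.1 + M * τ i.2.2) + Q * (d * i.2.1 + M * i.2.2) := by
      intro i
      calc d * ((i.1 : ℕ) + Q * i.2.1 + M * u i.2.2)
          = d * i.1 + Q * (d * i.2.1) + M * (d * u i.2.2) := by ring
        _ = _ := by rw [← hu]; ring
    have hlt : ∀ i : ι, d * (i.1 : ℕ) + M * τ i.2.2 < Q := by
      intro i
      have h1 := hτlt i.2.2
      have h2 : d * (i.1 : ℕ) + d ≤ d * I := by have := i.1.2; nlinarith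
      have h3 : M * τ i.2.2 ≤ M * d := Nat.mul_le_mul_left _ h1.le
      nlinarith
    have h2 : (d * (i.1 : ℕ) + M * τ i.2.2) + Q * (d * i.2.1 + M * i.2.2)
        = (d * i'.1 + M * τ i'.2.2) + Q * (d * i'.2.1 + M * i'.2.2) := by
      rw [← hw, ← hw, h]
    have hlow : d * (i.1 : ℕ) + M * τ i.2.2 = d * i'.1 + M * τ i'.2.2 := by
      have := congrArg (· % Q) h2
      simpa [Nat.add_mul_mod_self_left, Nat.mod_eq_of_lt (hlt i), Nat.mod_eq_of_lt (hlt i')]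
        using this
    have hhigh : d * (i.2.1 : ℕ) + M * i.2.2 = d * i'.2.1 + M * i'.2.2 := by
      rw [hlow] at h2
      exact Nat.eq_of_mul_eq_mul_left hQpos (Nat.add_left_cancel h2)
    have h3 : (i.2.2 : ℕ) = i'.2.2 := by
      have h4 : M * (i.2.2 : ℕ) ≡ M * i'.2.2 [MOD d] := by
        have := congrArg (· % d) hhigh
        simpa [Nat.ModEq] using this
      have h5 := Nat.ModEq.cancel_left_of_coprime (by rw [Nat.coprime_comm] at hcop; exact hcop) h4
      have := h5
      rwa [Nat.ModEq, Nat.mod_eq_of_lt i.2.2.2, Nat.mod_eq_of_lt i'.2.2.2] at this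
    have h4 : (i.2.1 : ℕ) = i'.2.1 := by
      rw [h3] at hhigh
      exact Nat.eq_of_mul_eq_mul_left hd0 (Nat.add_right_cancel hhigh)
    have h5 : (i.1 : ℕ) = i'.1 := by
      rw [h3] at hlow
      exact Nat.eq_of_mul_eq_mul_left hd0 (Nat.add_right_cancel hlow)
    exact Prod.ext (Fin.ext h5) (Prod.ext (Fin.ext h4) (Fin.ext h3))
  let h : K[X] := ∑ i : ι, C (Γ i ^ Q) * t i
  have hne : h ≠ 0 := by
    obtain ⟨i0, hi0⟩ : ∃ i, Γ i ≠ 0 := by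
      by_contra hcon; push Not at hcon; exact hΓ0 (funext hcon)
    obtain ⟨m, hm, hmax⟩ := (univ.filter (fun i => Γ i ≠ 0)).exists_max_image
      (fun i => (t i).natDegree) ⟨i0, by simpa using hi0⟩
    intro h0
    have hcoef : h.coeff (t m).natDegree = Γ m ^ Q := by
      simp only [h, finsetSum_coeff, coeff_C_mul]
      rw [Finset.sum_eq_single m]
      · rw [(htmonic m).coeff_natDegree, mul_one]
      · intro i _ him
        by_cases hi : Γ i = 0
        · simp [hi, hQpos.ne']
        · have h1 := hmax i (by simpa using hi)
          have h2 : (t i).natDegree ≠ (t m).natDegree := fun hh => him (htinj hh)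
          rw [coeff_eq_zero_of_natDegree_lt (lt_of_le_of_ne h1 h2), mul_zero]
      · simp
    rw [h0, coeff_zero] at hcoef
    have : Γ m ≠ 0 := by simpa using hm
    exact pow_ne_zero Q this hcoef.symm
  have hhdeg : h.natDegree ≤ I + Q * (Q / d + (2 * M + 2)) + M * (Q + 1) := by
    apply natDegree_sum_le_of_forall_le
    intro i _
    refine (natDegree_C_mul_le _ _).trans ?_
    rw [htdeg]
    have h1 := i.1.2
    have h2 : Q * (i.2.1 : ℕ) ≤ Q * (Q / d + (2 * M + 2)) := by
      apply Nat.mul_le_mul_left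
      have := i.2.1.2
      omega
    have h3 := hule i.2.2
    omega
  have hroots : (univ.filter (fun x : K => f.eval x ^ c = a)).card ≤ h.natDegree := by
    apply card_le_degree_of_subset_roots
    intro x hx
    have hx : f.eval x ^ c = a := by simpa using hx
    rw [mem_roots hne, IsRoot.def]
    have hxq : ∀ y : K, y ^ Q ^ 2 = y := fun y => by rw [← hK]; exact FiniteField.pow_card y
    have hpow : (h.eval x) ^ Q = 0 := by
      have hGx := congrArg (eval x) hG
      rw [eval_zero, eval_finsetSum] at hGx
      rw [← hGx]
      simp only [h, eval_finsetSum]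
      rw [hQ, sum_pow_char_pow, ← hQ]
      apply Finset.sum_congr rfl
      intro i _
      simp only [t, g, eval_mul, eval_pow, eval_X, eval_C, mul_pow]
      have q1 : (Γ i ^ Q) ^ Q = Γ i := by rw [← pow_mul, ← sq, hxq]
      have q2 : (eval x f ^ u i.2.2) ^ Q = eval x f ^ v i.2.2 * a ^ (i.2.2 : ℕ) := by
        rw [← pow_mul, mul_comm (u _) Q, huv, pow_add, pow_mul _ c, hx]
      have q3 : (x ^ (i.1 + Q * i.2.1 : ℕ)) ^ Q = x ^ (Q * i.1 + i.2.1 : ℕ) := by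
        rw [← pow_mul, show ((i.1 : ℕ) + Q * i.2.1) * Q = Q * i.1 + Q ^ 2 * i.2.1 by ring, pow_add,
          pow_mul x (Q ^ 2), hxq, ← pow_add]
      rw [q1, q2, q3]
      ring
    exact pow_eq_zero_iff hQpos.ne' |>.mp hpow
  have := hroots.trans hhdeg
  have e1 : I ≤ Q / d := by omega
  have e2 : Q / d ≤ Q := Nat.div_le_self _ _
  have e3 : I + Q * (Q / d + (2 * M + 2)) + M * (Q + 1) ≤ Q * (Q / d) + Q * (4 * M + 4) := by
    nlinarith
  calc _ ≤ d * (Q * (Q / d) + Q * (4 * M + 4)) := Nat.mul_le_mul_left _ (this.trans e3)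
    _ = Q * (d * (Q / d)) + d * Q * (4 * M + 4) := by ring
    _ ≤ _ := by nlinarith


theorem mulChar_norm_one {K : Type} [Field K] [Fintype K] (χ : MulChar K ℂ) {a : K} (ha : a ≠ 0) :
    ‖χ a‖ = 1 := by
  have h1 : a ^ (Fintype.card K - 1) = 1 := FiniteField.pow_card_sub_one_eq_one a ha
  have h2 : χ a ^ (Fintype.card K - 1) = 1 := by rw [← map_pow, h1, map_one]
  have : 1 < Fintype.card K := Fintype.one_lt_card
  exact Complex.norm_eq_one_of_pow_eq_one h2 (by omega)

theorem mulChar_norm_le_one {K : Type} [Field K] [Fintype K] (χ : MulChar K ℂ) (a : K) :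
    ‖χ a‖ ≤ 1 := by
  by_cases ha : a = 0
  · rw [ha, MulChar.map_zero]; simp
  · exact (mulChar_norm_one χ ha).le

/-- powers distinguished by a character of order d -/
theorem mulChar_pow_eq {K : Type} [Field K] [Fintype K] (χ : MulChar K ℂ) (d c : ℕ)
    (hχ : orderOf χ = d) (hdc : Fintype.card K - 1 = d * c) {u v : K} (hu : u ≠ 0) (hv : v ≠ 0)
    (h : χ u = χ v) : u ^ c = v ^ c := by
  classical
  obtain ⟨g, hg⟩ := IsCyclic.exists_generator (α := Kˣ)
  have key : ∀ w : Kˣ, χ w = 1 → w ^ c = 1 := by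
    intro w hw
    obtain ⟨k, hk⟩ := hg w
    simp only at hk
    have h1 : orderOf (χ g) = d := by
      rw [← hχ]
      apply dvd_antisymm
      · apply orderOf_dvd_of_pow_eq_one
        rw [← MulChar.pow_apply_coe, pow_orderOf_eq_one, MulChar.one_apply_coe]
      · apply orderOf_dvd_of_pow_eq_one
        rw [MulChar.eq_iff hg, MulChar.pow_apply_coe, pow_orderOf_eq_one, MulChar.one_apply_coe]
    have h2 : orderOf (χ.toUnitHom g) = d := by
      rw [← h1, ← orderOf_units, MulChar.coe_toUnitHom]
    have h3 : χ.toUnitHom g ^ k = 1 := by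
      rw [← map_zpow, hk]
      ext; rw [MulChar.coe_toUnitHom, hw]; rfl
    have h4 : (d : ℤ) ∣ k := by rw [← h2]; exact orderOf_dvd_iff_zpow_eq_one.mpr h3
    obtain ⟨l, hl⟩ := h4
    have h5 : g ^ (d * c) = 1 := by
      rw [← hdc, ← Fintype.card_units]; exact pow_card_eq_one
    rw [← hk, ← zpow_natCast, ← zpow_mul, hl, show (d : ℤ) * l * c = ((d * c : ℕ) : ℤ) * l by push_cast; ring,
      zpow_mul, zpow_natCast, h5, one_zpow]
  have h1 := key (Units.mk0 (u / v) (div_ne_zero hu hv)) (by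
    simp only [Units.val_mk0]
    have h0 : χ v ≠ 0 := by
      intro h0; have := mulChar_norm_one χ hv; rw [h0] at this; simp at this
    have h2 : χ (u / v) * χ v = χ v := by
      rw [← map_mul, div_mul_cancel₀ _ hv, h]
    exact mul_right_cancel₀ h0 (by rw [h2, one_mul]))
  have h2 := congrArg Units.val h1
  simp only [Units.val_pow_eq_pow_val, Units.val_mk0, Units.val_one, div_pow] at h2
  exact (div_eq_one_iff_eq (pow_ne_zero _ hv)).mp h2

open Polynomial in
theorem sum_nthRoots_eq_zero (d : ℕ) (hd : 2 ≤ d) : ∑ w ∈ nthRootsFinset d (1 : ℂ), w = 0 := by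
  have hζ := Complex.isPrimitiveRoot_exp d (by omega)
  set ζ := Complex.exp (2 * Real.pi * Complex.I / d)
  have h1 : ∑ w ∈ nthRootsFinset d (1 : ℂ), ζ * w = ∑ w ∈ nthRootsFinset d (1 : ℂ), w := by
    apply Finset.sum_bij (fun w _ => ζ * w)
    · intro w hw
      rw [mem_nthRootsFinset (by omega)] at hw ⊢
      rw [mul_pow, hζ.pow_eq_one, hw, one_mul]
    · intro a _ b _ h
      exact mul_left_cancel₀ (hζ.ne_zero (by omega)) h
    · intro b hb
      refine ⟨ζ⁻¹ * b, ?_, ?_⟩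
      · rw [mem_nthRootsFinset (by omega)] at hb ⊢
        rw [mul_pow, inv_pow, hζ.pow_eq_one, hb]; simp
      · rw [mul_inv_cancel_left₀ (hζ.ne_zero (by omega))]
    · intros; rfl
  rw [← Finset.mul_sum] at h1
  have h2 : (ζ - 1) * ∑ w ∈ nthRootsFinset d (1 : ℂ), w = 0 := by rw [sub_mul, h1]; ring
  rcases mul_eq_zero.mp h2 with h | h
  · exact absurd (sub_eq_zero.mp h) (hζ.ne_one (by omega))
  · exact h

open Polynomial in
theorem stepanov_sum {K : Type} [Field K] [Fintype K] (p k Q d M : ℕ)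
    [Fact p.Prime] [CharP K p] (hQ : Q = p ^ k) (hK : Fintype.card K = Q ^ 2) (hd : 2 ≤ d)
    (f : K[X]) (hf : f.Monic) (hM : f.natDegree = M)
    (hcop : M.Coprime d) (ψ : MulChar K ℂ) (hψ : orderOf ψ = d) :
    ‖∑ x : K, ψ (f.eval x)‖ ≤ ((d * (4 * M + 4) + M + 2 * d * (M + 2) : ℕ) : ℝ) * Q := by
  classical
  have hdvd : d ∣ Q ^ 2 - 1 := by
    rw [← hK, ← hψ]; exact MulChar.orderOf_dvd_card_sub_one (χ := ψ)
  have hQpos : 0 < Q := by rw [hQ]; exact pow_pos (Fact.out : p.Prime).pos k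
  by_cases hQ0 : 2 * d * (M + 2) ≤ Q
  swap
  · push Not at hQ0
    calc ‖∑ x : K, ψ (f.eval x)‖ ≤ ∑ x : K, ‖ψ (f.eval x)‖ := norm_sum_le _ _
      _ ≤ ∑ x : K, (1 : ℝ) := Finset.sum_le_sum fun x _ => mulChar_norm_le_one ψ _
      _ = ((Q * Q : ℕ) : ℝ) := by simp [hK, sq]
      _ ≤ (((d * (4 * M + 4) + M + 2 * d * (M + 2)) * Q : ℕ) : ℝ) := by
        exact_mod_cast Nat.mul_le_mul_right Q (by omega)
      _ = _ := by push_cast; ring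
  set B : ℕ := Q ^ 2 + d * Q * (4 * M + 4) with hB
  set W := nthRootsFinset d (1 : ℂ) with hW
  have hWcard : W.card = d := (Complex.isPrimitiveRoot_exp d (by omega)).card_nthRootsFinset
  let n : ℂ → ℕ := fun w => (univ.filter (fun x : K => ψ (f.eval x) = w)).card
  have hw0 : ∀ w ∈ W, ‖w‖ = 1 := by
    intro w hw
    rw [hW, mem_nthRootsFinset (by omega)] at hw
    exact Complex.norm_eq_one_of_pow_eq_one hw (by omega)
  have hfne : ∀ x : K, ∀ w ∈ W, ψ (f.eval x) = w → f.eval x ≠ 0 := by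
    intro x w hw h h0
    rw [h0, MulChar.map_zero] at h
    have := hw0 w hw
    rw [← h] at this; simp at this
  have hn : ∀ w ∈ W, d * n w ≤ B := by
    intro w hw
    by_cases he : (univ.filter (fun x : K => ψ (f.eval x) = w)) = ∅
    · simp [n, he]
    · obtain ⟨x0, hx0⟩ := Finset.nonempty_iff_ne_empty.mpr he
      have hx0 : ψ (f.eval x0) = w := by simpa using hx0
      refine le_trans ?_ (stepanov_count p k Q d M hQ hK hd hdvd f hf hM hcop hQ0
        (f.eval x0 ^ ((Q ^ 2 - 1) / d)))
      apply Nat.mul_le_mul_left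
      apply Finset.card_le_card
      intro x hx
      have hx : ψ (f.eval x) = w := by simpa using hx
      simp only [Finset.mem_filter, Finset.mem_univ, true_and]
      apply mulChar_pow_eq ψ d _ hψ _ (hfne x w hw hx) (hfne x0 w hw hx0) (by rw [hx, hx0])
      rw [hK, Nat.mul_div_cancel' hdvd]
  have hmaps : ∀ x ∈ univ.filter (fun x : K => f.eval x ≠ 0), ψ (f.eval x) ∈ W := by
    intro x hx
    have hx : f.eval x ≠ 0 := by simpa using hx
    rw [hW, mem_nthRootsFinset (by omega)]
    rw [← MulChar.pow_apply' _ (by omega), ← hψ, pow_orderOf_eq_one, MulChar.one_apply hx.isUnit]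
  have hnf : ∀ w ∈ W, (univ.filter (fun x : K => f.eval x ≠ 0)).filter (fun x => ψ (f.eval x) = w)
      = univ.filter (fun x : K => ψ (f.eval x) = w) := by
    intro w hw
    ext x
    simp only [Finset.mem_filter, Finset.mem_univ, true_and]
    exact ⟨fun h => h.2, fun h => ⟨hfne x w hw h, h⟩⟩
  have hsum : ∑ x : K, ψ (f.eval x) = ∑ w ∈ W, (n w : ℂ) * w := by
    have h1 : ∑ x : K, ψ (f.eval x) = ∑ x ∈ univ.filter (fun x : K => f.eval x ≠ 0), ψ (f.eval x) := by
      rw [Finset.sum_filter]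
      apply Finset.sum_congr rfl
      intro x _
      split_ifs with h
      · rfl
      · push Not at h; rw [h, MulChar.map_zero]
    rw [h1, ← Finset.sum_fiberwise_of_maps_to hmaps]
    apply Finset.sum_congr rfl
    intro w hw
    rw [hnf w hw, Finset.sum_congr rfl (g := fun _ => w)]
    · simp [n]
    · intro x hx; simpa using hx
  have hcnt : Q ^ 2 ≤ ∑ w ∈ W, n w + M := by
    have h1 : (univ.filter (fun x : K => f.eval x ≠ 0)).card = ∑ w ∈ W, n w := by
      rw [Finset.card_eq_sum_card_fiberwise hmaps]
      apply Finset.sum_congr rfl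
      intro w hw
      rw [hnf w hw]
    have h2 : (univ.filter (fun x : K => f.eval x = 0)).card ≤ M := by
      rw [← hM]
      apply card_le_degree_of_subset_roots
      intro x hx
      rw [mem_roots hf.ne_zero]
      simpa using hx
    have h3 := Finset.card_filter_add_card_filter_not (s := (univ : Finset K)) (fun x => f.eval x = 0)
    rw [Finset.card_univ, hK] at h3
    have h4 : (univ.filter (fun x : K => ¬ f.eval x = 0)).card = ∑ w ∈ W, n w := h1
    omega
  have hfin : (d : ℂ) * ∑ x : K, ψ (f.eval x) = ∑ w ∈ W, ((d * n w : ℝ) - B : ℝ) * w := by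
    rw [hsum, Finset.mul_sum]
    have : ∑ w ∈ W, (((d * n w : ℝ) - B : ℝ) : ℂ) * w = ∑ w ∈ W, ((d : ℂ) * (n w * w)) - B * ∑ w ∈ W, w := by
      rw [Finset.mul_sum, ← Finset.sum_sub_distrib]
      apply Finset.sum_congr rfl
      intro w _; push_cast; ring
    rw [this, sum_nthRoots_eq_zero d hd]; ring
  have hdpos : (0 : ℝ) < d := by exact_mod_cast (by omega : 0 < d)
  have h5 : (d : ℝ) * ‖∑ x : K, ψ (f.eval x)‖ ≤ d * ((d * (4 * M + 4) + M : ℝ) * Q) := by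
    calc (d : ℝ) * ‖∑ x : K, ψ (f.eval x)‖ = ‖(d : ℂ) * ∑ x : K, ψ (f.eval x)‖ := by
          rw [norm_mul]; simp
      _ ≤ ∑ w ∈ W, ‖(((d * n w : ℝ) - B : ℝ) : ℂ) * w‖ := by rw [hfin]; exact norm_sum_le _ _
      _ = ∑ w ∈ W, ((B : ℝ) - d * n w) := by
          apply Finset.sum_congr rfl
          intro w hw
          rw [norm_mul, hw0 w hw, mul_one, Complex.norm_real, Real.norm_eq_abs, abs_sub_comm,
            abs_of_nonneg]
          have : ((d * n w : ℕ) : ℝ) ≤ B := by exact_mod_cast hn w hw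
          push_cast at this; linarith
      _ = d * B - d * ((∑ w ∈ W, n w : ℕ) : ℝ) := by
          rw [Finset.sum_sub_distrib, Finset.sum_const, hWcard, nsmul_eq_mul, ← Finset.mul_sum]
          push_cast; rfl
      _ ≤ d * B - d * (Q ^ 2 - M) := by
          have : (Q ^ 2 : ℝ) ≤ ((∑ w ∈ W, n w : ℕ) : ℝ) + M := by exact_mod_cast hcnt
          nlinarith
      _ = d * (d * Q * (4 * M + 4) + M) := by rw [hB]; push_cast; ring
      _ ≤ _ := by
          apply mul_le_mul_of_nonneg_left _ hdpos.le
          have : (1 : ℝ) ≤ Q := by exact_mod_cast hQpos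
          have hM0 : (0 : ℝ) ≤ M := Nat.cast_nonneg M
          nlinarith
  have h6 := le_of_mul_le_mul_left h5 hdpos
  refine h6.trans ?_
  apply mul_le_mul_of_nonneg_right _ (Nat.cast_nonneg Q)
  push_cast
  have : (0 : ℝ) ≤ 2 * d * (M + 2) := by positivity
  linarith


section EulerSection
open Polynomial

theorem finite_monics (F : Type) [Field F] [Fintype F] (k : ℕ) :
    {g : F[X] | g.Monic ∧ g.natDegree = k}.Finite := by
  have h : Finite (degreeLT F k) := Finite.of_equiv _ (degreeLTEquiv F k).symm.toEquiv
  have : Finite { p : F[X] // p.Monic ∧ p.natDegree = k } :=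
    Finite.of_equiv _ (monicEquivDegreeLT k).symm
  exact @Set.toFinite _ _ this

/-- Monic polynomials of degree `k` over a finite field. -/
noncomputable def monics (F : Type) [Field F] [Fintype F] (k : ℕ) : Finset F[X] :=
  (finite_monics F k).toFinset

open Classical in
/-- Irreducible monic polynomials of degree `k` over a finite field. -/
noncomputable def irreds (F : Type) [Field F] [Fintype F] (k : ℕ) : Finset F[X] :=
  (monics F k).filter Irreducible

variable {F : Type} [Field F] [Fintype F]

theorem mem_monics {k : ℕ} {g : F[X]} : g ∈ monics F k ↔ g.Monic ∧ g.natDegree = k := by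
  simp [monics]

theorem mem_irreds {k : ℕ} {g : F[X]} :
    g ∈ irreds F k ↔ (g.Monic ∧ g.natDegree = k) ∧ Irreducible g := by
  classical
  simp [irreds, mem_monics]

/-- Coefficients of the L-function. -/
noncomputable def Lcoef (l : F[X] →* ℂ) (k : ℕ) : ℂ := ∑ g ∈ monics F k, l g

/-- Power sums attached to the L-function. -/
noncomputable def Lpow (l : F[X] →* ℂ) (j : ℕ) : ℂ :=
  ∑ x ∈ j.divisorsAntidiagonal, ∑ P ∈ irreds F x.1, (x.1 : ℂ) * l P ^ x.2

theorem sum_divisors_reindex (n : ℕ) (f : ℕ × ℕ → ℂ) :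
    ∑ j ∈ Icc 1 n, ∑ x ∈ j.divisorsAntidiagonal, f x
      = ∑ x ∈ (Icc 1 n ×ˢ Icc 1 n).filter (fun x => x.1 * x.2 ≤ n), f x := by
  have hm : ∀ x ∈ (Icc 1 n ×ˢ Icc 1 n).filter (fun x : ℕ × ℕ => x.1 * x.2 ≤ n),
      x.1 * x.2 ∈ Icc 1 n := by
    intro x hx
    simp only [Finset.mem_filter, Finset.mem_product, Finset.mem_Icc] at hx ⊢
    exact ⟨Nat.mul_pos hx.1.1.1 hx.1.2.1, hx.2⟩
  rw [← Finset.sum_fiberwise_of_maps_to hm]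
  apply Finset.sum_congr rfl
  intro j hj
  apply Finset.sum_congr _ (fun _ _ => rfl)
  ext x
  simp only [Nat.mem_divisorsAntidiagonal, Finset.mem_filter, Finset.mem_product, Finset.mem_Icc] at hj ⊢
  constructor
  · rintro ⟨h1, h2⟩
    have hx1 : 0 < x.1 := Nat.pos_of_ne_zero (by rintro h; simp [h] at h1; omega)
    have hx2 : 0 < x.2 := Nat.pos_of_ne_zero (by rintro h; simp [h] at h1; omega)
    refine ⟨⟨⟨⟨hx1, ?_⟩, ⟨hx2, ?_⟩⟩, ?_⟩, h1⟩ <;> nlinarith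
  · rintro ⟨h1, h2⟩
    exact ⟨h2, by omega⟩

open Classical in
theorem degree_formula (n : ℕ) (g : F[X]) (hg : g ∈ monics F n) :
    ∑ x ∈ (Icc 1 n ×ˢ Icc 1 n).filter (fun x => x.1 * x.2 ≤ n),
      ∑ P ∈ irreds F x.1, (if P ^ x.2 ∣ g then (x.1 : ℂ) else 0) = n := by
  obtain ⟨hgm, hgn⟩ := mem_monics.mp hg
  have hg0 := hgm.ne_zero
  have h1 : ∑ x ∈ (Icc 1 n ×ˢ Icc 1 n).filter (fun x => x.1 * x.2 ≤ n),
      ∑ P ∈ irreds F x.1, (if P ^ x.2 ∣ g then (x.1 : ℂ) else 0)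
      = ∑ e ∈ Icc 1 n, ∑ P ∈ irreds F e, ∑ k ∈ Icc 1 n, (if P ^ k ∣ g then (e : ℂ) else 0) := by
    rw [Finset.sum_filter, Finset.sum_product]
    apply Finset.sum_congr rfl
    intro e he
    rw [Finset.sum_comm]
    apply Finset.sum_congr rfl
    intro k hk
    split_ifs with h
    · rfl
    · symm
      apply Finset.sum_eq_zero
      intro P hP
      rw [if_neg]
      intro hdvd
      apply h
      have := natDegree_le_of_dvd hdvd hg0
      rw [natDegree_pow, (mem_irreds.mp hP).1.2, hgn] at this
      simp only; nlinarith
  rw [h1]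
  have h2 : ∀ e, ∀ P ∈ irreds F e, ∑ k ∈ Icc 1 n, (if P ^ k ∣ g then (e : ℂ) else 0)
      = ((UniqueFactorizationMonoid.normalizedFactors g).count P * P.natDegree : ℕ) := by
    intro e P hP
    obtain ⟨⟨hPm, hPe⟩, hPi⟩ := mem_irreds.mp hP
    set c := (UniqueFactorizationMonoid.normalizedFactors g).count P with hc
    have hiff : ∀ k, P ^ k ∣ g ↔ k ≤ c := by
      intro k
      rw [pow_dvd_iff_le_emultiplicity,
        UniqueFactorizationMonoid.emultiplicity_eq_count_normalizedFactors hPi hg0,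
        hPm.normalize_eq_self]
      exact_mod_cast Iff.rfl
    have hcn : c ≤ n := by
      have := natDegree_le_of_dvd ((hiff c).mpr le_rfl) hg0
      rw [natDegree_pow, hgn] at this
      have := hPi.natDegree_pos
      nlinarith
    simp_rw [hiff]
    rw [← Finset.sum_filter]
    have : (Icc 1 n).filter (fun k => k ≤ c) = Icc 1 c := by
      ext k; simp only [Finset.mem_filter, Finset.mem_Icc]; omega
    rw [this, Finset.sum_const, Nat.card_Icc, hPe]
    simp
  rw [Finset.sum_congr rfl (fun e _ => Finset.sum_congr rfl (h2 e))]
  set nf := UniqueFactorizationMonoid.normalizedFactors g with hnf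
  have hnfm : ∀ P ∈ nf, P.Monic := fun P hP => by
    have h := UniqueFactorizationMonoid.normalize_normalized_factor P hP
    rw [← h]; exact monic_normalize (UniqueFactorizationMonoid.prime_of_normalized_factor P hP).ne_zero
  have hprod : nf.prod = g := by
    rw [hnf, UniqueFactorizationMonoid.prod_normalizedFactors_eq hg0, hgm.normalize_eq_self]
  have h3 : n = ∑ P ∈ nf.toFinset, nf.count P * P.natDegree := by
    rw [← hgn, ← hprod, natDegree_multiset_prod_of_monic _ hnfm, Finset.sum_multiset_map_count]
    simp
  have h4 : ∑ P ∈ nf.toFinset, nf.count P * P.natDegree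
      = ∑ e ∈ Icc 1 n, ∑ P ∈ irreds F e, nf.count P * P.natDegree := by
    have hm : ∀ P ∈ nf.toFinset, P.natDegree ∈ Icc 1 n := by
      intro P hP
      rw [Multiset.mem_toFinset] at hP
      have h5 := (UniqueFactorizationMonoid.irreducible_of_normalized_factor P hP).natDegree_pos
      have h6 := natDegree_le_of_dvd (UniqueFactorizationMonoid.dvd_of_mem_normalizedFactors hP) hg0
      simp only [Finset.mem_Icc]; omega
    rw [← Finset.sum_fiberwise_of_maps_to hm]
    apply Finset.sum_congr rfl
    intro e he
    apply Finset.sum_subset_zero_on_sdiff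
    · intro P hP
      rw [Finset.mem_filter, Multiset.mem_toFinset] at hP
      exact mem_irreds.mpr ⟨⟨hnfm P hP.1, hP.2⟩,
        UniqueFactorizationMonoid.irreducible_of_normalized_factor P hP.1⟩
    · intro P hP
      rw [Finset.mem_sdiff, Finset.mem_filter, Multiset.mem_toFinset] at hP
      have : P ∉ nf := fun h => hP.2 ⟨h, (mem_irreds.mp hP.1).1.2⟩
      rw [Multiset.count_eq_zero_of_notMem this, zero_mul]
    · intros; rfl
  conv_rhs => rw [h3, h4]
  push_cast
  rfl

theorem euler_identity (l : F[X] →* ℂ) (n : ℕ) :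
    (n : ℂ) * Lcoef l n = ∑ j ∈ Icc 1 n, Lpow l j * Lcoef l (n - j) := by
  classical
  have key : ∀ e k : ℕ, e * k ≤ n → ∀ P ∈ irreds F e,
      ∑ g ∈ monics F n, l g * (if P ^ k ∣ g then (e : ℂ) else 0)
        = (e : ℂ) * l P ^ k * Lcoef l (n - e * k) := by
    intro e k hek P hP
    obtain ⟨⟨hPm, hPe⟩, hPi⟩ := mem_irreds.mp hP
    have hkm := hPm.pow k
    have hkd : (P ^ k).natDegree = e * k := by rw [natDegree_pow, hPe, mul_comm]
    simp_rw [mul_ite, mul_zero]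
    rw [← Finset.sum_filter, Lcoef, Finset.mul_sum]
    symm
    apply Finset.sum_bij (fun h _ => P ^ k * h)
    · intro h hh
      obtain ⟨h1, h2⟩ := mem_monics.mp hh
      rw [Finset.mem_filter, mem_monics]
      refine ⟨⟨hkm.mul h1, ?_⟩, dvd_mul_right _ _⟩
      rw [hkm.natDegree_mul h1, hkd, h2]; omega
    · intro h1 _ h2 _ h
      exact mul_left_cancel₀ hkm.ne_zero h
    · intro g hg
      rw [Finset.mem_filter, mem_monics] at hg
      obtain ⟨⟨h1, h2⟩, h, rfl⟩ := hg
      have h3 := hkm.of_mul_monic_left h1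
      refine ⟨h, mem_monics.mpr ⟨h3, ?_⟩, rfl⟩
      rw [hkm.natDegree_mul h3, hkd] at h2; omega
    · intro h _
      rw [map_mul, map_pow]; ring
  calc (n : ℂ) * Lcoef l n
      = ∑ g ∈ monics F n, l g * ∑ x ∈ (Icc 1 n ×ˢ Icc 1 n).filter (fun x => x.1 * x.2 ≤ n),
          ∑ P ∈ irreds F x.1, (if P ^ x.2 ∣ g then (x.1 : ℂ) else 0) := by
        rw [Lcoef, Finset.mul_sum]
        apply Finset.sum_congr rfl
        intro g hg
        rw [degree_formula n g hg, mul_comm]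
    _ = ∑ x ∈ (Icc 1 n ×ˢ Icc 1 n).filter (fun x => x.1 * x.2 ≤ n), ∑ P ∈ irreds F x.1,
          ∑ g ∈ monics F n, l g * (if P ^ x.2 ∣ g then (x.1 : ℂ) else 0) := by
        simp_rw [Finset.mul_sum]
        rw [Finset.sum_comm]
        apply Finset.sum_congr rfl
        intro x _
        rw [Finset.sum_comm]
    _ = ∑ x ∈ (Icc 1 n ×ˢ Icc 1 n).filter (fun x => x.1 * x.2 ≤ n), ∑ P ∈ irreds F x.1,
          (x.1 : ℂ) * l P ^ x.2 * Lcoef l (n - x.1 * x.2) := by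
        apply Finset.sum_congr rfl
        intro x hx
        apply Finset.sum_congr rfl
        intro P hP
        exact key x.1 x.2 (Finset.mem_filter.mp hx).2 P hP
    _ = ∑ j ∈ Icc 1 n, ∑ x ∈ j.divisorsAntidiagonal, ∑ P ∈ irreds F x.1,
          (x.1 : ℂ) * l P ^ x.2 * Lcoef l (n - x.1 * x.2) := by
        rw [sum_divisors_reindex n (fun x => ∑ P ∈ irreds F x.1,
          (x.1 : ℂ) * l P ^ x.2 * Lcoef l (n - x.1 * x.2))]
    _ = _ := by
        apply Finset.sum_congr rfl
        intro j _
        rw [Lpow, Finset.sum_mul]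
        apply Finset.sum_congr rfl
        intro x hx
        rw [Finset.sum_mul, (Nat.mem_divisorsAntidiagonal.mp hx).1]

theorem card_minpoly_fiber (L : Type) [Field L] [Fintype L] [DecidableEq L] [Algebra F L]
    (e : ℕ) (he : e ∣ Module.finrank F L) (P : F[X]) (hP : P ∈ irreds F e) [DecidableEq F[X]] :
    (univ.filter (fun x : L => minpoly F x = P)).card = e := by
  obtain ⟨⟨hPm, hPe⟩, hPi⟩ := mem_irreds.mp hP
  have hcardL : Fintype.card L = Fintype.card F ^ Module.finrank F L := Module.card_eq_pow_finrank
  have hdvd : P ∣ X ^ Fintype.card L - X := by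
    rw [hcardL, ← Nat.card_eq_fintype_card]
    exact hPi.natDegree_dvd_iff_dvd_X_pow_card_pow_sub_X.mp (hPe ▸ he)
  have hspl := FiniteField.isSplittingField_sub L F
  have hcard1 : 1 < Fintype.card L := Fintype.one_lt_card
  have hne : (X ^ Fintype.card L - X : F[X]) ≠ 0 := FiniteField.X_pow_card_sub_X_ne_zero F hcard1
  have hsplits : (P.map (algebraMap F L)).Splits :=
    Splits.of_dvd hspl.splits (Polynomial.map_ne_zero hne) (Polynomial.map_dvd _ hdvd)
  have hsep : P.Separable := PerfectField.separable_of_irreducible hPi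
  have h1 := card_rootSet_eq_natDegree hsep hsplits
  rw [hPe] at h1
  rw [← h1, ← Set.toFinset_card]
  congr 1
  ext x
  rw [Finset.mem_filter, Set.mem_toFinset, mem_rootSet]
  constructor
  · rintro ⟨_, rfl⟩
    exact ⟨hPm.ne_zero, minpoly.aeval F x⟩
  · rintro ⟨_, h⟩
    exact ⟨Finset.mem_univ _, (minpoly.eq_of_irreducible_of_monic hPi h hPm).symm⟩

theorem Lpow_eq_sum (l : F[X] →* ℂ) (L : Type) [Field L] [Fintype L] [Algebra F L] :
    Lpow l (Module.finrank F L)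
      = ∑ x : L, l (minpoly F x) ^ (Module.finrank F L / (minpoly F x).natDegree) := by
  classical
  set j := Module.finrank F L with hj
  have hj0 : j ≠ 0 := Module.finrank_pos.ne'
  have hm : ∀ x ∈ (univ : Finset L), ((minpoly F x).natDegree, j / (minpoly F x).natDegree)
      ∈ j.divisorsAntidiagonal := by
    intro x _
    rw [Nat.mem_divisorsAntidiagonal]
    exact ⟨Nat.mul_div_cancel' (minpoly.degree_dvd (Algebra.IsIntegral.isIntegral x)), hj0⟩
  rw [Lpow, ← Finset.sum_fiberwise_of_maps_to hm]
  apply Finset.sum_congr rfl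
  intro y hy
  rw [Nat.mem_divisorsAntidiagonal] at hy
  have hm2 : ∀ x ∈ univ.filter (fun x : L => ((minpoly F x).natDegree,
      j / (minpoly F x).natDegree) = y), minpoly F x ∈ irreds F y.1 := by
    intro x hx
    rw [Finset.mem_filter] at hx
    have hi := Algebra.IsIntegral.isIntegral (R := F) x
    exact mem_irreds.mpr ⟨⟨minpoly.monic hi, by rw [← hx.2]⟩, minpoly.irreducible hi⟩
  rw [← Finset.sum_fiberwise_of_maps_to hm2]
  apply Finset.sum_congr rfl
  intro P hP
  have hset : (univ.filter (fun x : L => ((minpoly F x).natDegree,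
      j / (minpoly F x).natDegree) = y)).filter (fun x => minpoly F x = P)
      = univ.filter (fun x : L => minpoly F x = P) := by
    ext x
    simp only [Finset.mem_filter, Finset.mem_univ, true_and]
    refine ⟨fun h => h.2, fun h => ⟨?_, h⟩⟩
    rw [h, (mem_irreds.mp hP).1.2]
    have hy1 : 0 < y.1 := Nat.pos_of_ne_zero (by rintro h; rw [h] at hy; simp at hy; omega)
    rw [← hy.1, Nat.mul_div_cancel_left _ hy1]
  rw [hset, Finset.sum_congr rfl (g := fun _ => l P ^ y.2)]
  · rw [Finset.sum_const, card_minpoly_fiber L y.1 (hj ▸ ⟨y.2, hy.1.symm⟩) P hP, nsmul_eq_mul]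
  · intro x hx
    have h1 : x ∈ (univ.filter (fun x : L => ((minpoly F x).natDegree,
      j / (minpoly F x).natDegree) = y)).filter (fun x => minpoly F x = P) := by rw [hset]; exact hx
    rw [Finset.mem_filter, Finset.mem_filter] at h1
    rw [h1.2]
    have := congrArg Prod.snd h1.1.2
    simp only [h1.2] at this
    rw [this]

theorem norm_sub_eq (L : Type) [Field L] [Fintype L] [Algebra F L] (x : L) (b : F) :
    Algebra.norm F (algebraMap F L b - x)
      = (minpoly F x).eval b ^ (Module.finrank F L / (minpoly F x).natDegree) := by
  have hi := Algebra.IsIntegral.isIntegral (R := F) x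
  let E := IntermediateField.adjoin F {x}
  let y : E := algebraMap F E b - IntermediateField.AdjoinSimple.gen F x
  have hy : algebraMap E L y = algebraMap F L b - x := by
    rfl
  have hfin : Module.finrank F E = (minpoly F x).natDegree := IntermediateField.adjoin.finrank hi
  have hdeg : Module.finrank F L / (minpoly F x).natDegree = Module.finrank E L := by
    rw [← Module.finrank_mul_finrank F E L, hfin, Nat.mul_div_cancel_left _ (minpoly.natDegree_pos hi)]
  rw [hdeg, ← hy, ← Algebra.norm_norm (S := E), Algebra.norm_algebraMap, map_pow]
  congr 1
  let pb := IntermediateField.adjoin.powerBasis hi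
  have hg : pb.gen = IntermediateField.AdjoinSimple.gen F x := rfl
  have h1 := charpoly_leftMulMatrix pb
  rw [hg, IntermediateField.minpoly_gen] at h1
  rw [← h1, Matrix.eval_charpoly, Algebra.norm_eq_matrix_det pb.basis, map_sub]
  congr 2
  rw [AlgHom.commutes]; rfl
end EulerSection


section CharSection
open Polynomial
variable {F : Type} [Field F] [Fintype F]

/-- The multiplicative function attached to a character and points. -/
noncomputable def charL (χ : MulChar F ℂ) {ι : Type} [Fintype ι] (b : ι → F) (e : ι → ℕ) :
    F[X] →* ℂ where
  toFun g := ∏ i, χ (g.eval (b i)) ^ e i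
  map_one' := by simp
  map_mul' g h := by simp [mul_pow, Finset.prod_mul_distrib]

theorem charL_apply (χ : MulChar F ℂ) {ι : Type} [Fintype ι] (b : ι → F) (e : ι → ℕ) (g : F[X]) :
    charL χ b e g = ∏ i, χ (g.eval (b i)) ^ e i := rfl

theorem Lcoef_zero (l : F[X] →* ℂ) : Lcoef l 0 = 1 := by
  have : monics F 0 = {1} := by
    ext g
    rw [mem_monics, Finset.mem_singleton]
    constructor
    · rintro ⟨h1, h2⟩; exact h1.natDegree_eq_zero.mp h2
    · rintro rfl; exact ⟨monic_one, natDegree_one⟩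
  rw [Lcoef, this, Finset.sum_singleton, map_one]

theorem Lcoef_vanish (χ : MulChar F ℂ) (d : ℕ) (hχ : orderOf χ = d) (hd : 2 ≤ d) {ι : Type}
    [Fintype ι] (b : ι → F) (e : ι → ℕ) (hcop : (∑ i, e i).Coprime d) (k : ℕ)
    (hk : Fintype.card ι ≤ k) : Lcoef (charL χ b e) k = 0 := by
  classical
  obtain ⟨b0, hb0⟩ : ∃ c : F, ¬ d ∣ ∑ i with b i = c, e i := by
    by_contra! h
    have : d ∣ ∑ i, e i := by
      rw [← Finset.sum_fiberwise univ b e]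
      exact Finset.dvd_sum (fun c _ => h c)
    have h1 := Nat.Coprime.eq_one_of_dvd hcop.symm this
    omega
  set E := ∑ i with b i = b0, e i with hE
  have hE0 : E ≠ 0 := by rintro h; rw [h] at hb0; simp at hb0
  have hχE : χ ^ E ≠ 1 := fun h => hb0 (hχ ▸ orderOf_dvd_of_pow_eq_one h)
  obtain ⟨i0, hi0⟩ : ∃ i0, b i0 = b0 := by
    by_contra! h
    apply hE0
    rw [hE, Finset.filter_false_of_mem (fun i _ => h i), Finset.sum_empty]
  set S := (univ.image b).erase b0 with hS
  set ℓ : F[X] := ∏ c ∈ S, (X - C c) with hℓ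
  have hℓd : ℓ.natDegree < k := by
    rw [hℓ, natDegree_prod_of_monic _ _ (fun c _ => monic_X_sub_C c)]
    simp only [natDegree_X_sub_C, Finset.sum_const, smul_eq_mul, mul_one]
    have h1 : b0 ∈ univ.image b := Finset.mem_image.mpr ⟨i0, Finset.mem_univ _, hi0⟩
    have h2 := Finset.card_erase_of_mem h1
    rw [← hS] at h2
    have h3 : (univ.image b).card ≤ Fintype.card ι := Finset.card_image_le
    have h4 := Finset.card_pos.mpr ⟨b0, h1⟩
    omega
  have hℓ0 : ℓ.eval b0 ≠ 0 := by
    rw [hℓ, eval_prod, Finset.prod_ne_zero_iff]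
    intro c hc
    simp only [eval_sub, eval_X, eval_C]
    rw [sub_ne_zero]
    rintro rfl
    simp [hS] at hc
  have hℓb : ∀ i, b i ≠ b0 → ℓ.eval (b i) = 0 := by
    intro i hi
    rw [hℓ, eval_prod]
    apply Finset.prod_eq_zero (i := b i)
    · rw [hS, Finset.mem_erase]; exact ⟨hi, Finset.mem_image_of_mem _ (Finset.mem_univ _)⟩
    · simp
  have hdeg : ∀ u : F, (C u * ℓ).natDegree < k := fun u =>
    lt_of_le_of_lt (natDegree_C_mul_le u ℓ) hℓd
  have hmem : ∀ u : F, ∀ g ∈ monics F k, g + C u * ℓ ∈ monics F k := by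
    intro u g hg
    rw [mem_monics] at hg ⊢
    have h1 : (C u * ℓ).natDegree < g.natDegree := by rw [hg.2]; exact hdeg u
    refine ⟨hg.1.add_of_left (degree_lt_degree h1), ?_⟩
    rw [natDegree_add_eq_left_of_natDegree_lt h1, hg.2]
  have hshift : ∀ u : F, ∑ g ∈ monics F k, charL χ b e (g + C u * ℓ) = Lcoef (charL χ b e) k := by
    intro u
    rw [Lcoef]
    apply Finset.sum_bij' (fun g _ => g + C u * ℓ) (fun g _ => g + C (-u) * ℓ)
    · exact fun g hg => hmem u g hg
    · exact fun g hg => hmem (-u) g hg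
    · intro g _; simp
    · intro g _; simp
    · intro g _; rfl
  have hz : ∑ u : F, ∑ g ∈ monics F k, charL χ b e (g + C u * ℓ) = 0 := by
    rw [Finset.sum_comm]
    apply Finset.sum_eq_zero
    intro g _
    have h1 : ∀ u : F, charL χ b e (g + C u * ℓ)
        = (χ ^ E) (g.eval b0 + u * ℓ.eval b0) * ∏ i with ¬ b i = b0, χ (g.eval (b i)) ^ e i := by
      intro u
      rw [charL_apply, ← Finset.prod_filter_mul_prod_filter_not univ (fun i => b i = b0)]
      congr 1
      · rw [MulChar.pow_apply' _ hE0, hE, ← Finset.prod_pow_eq_pow_sum]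
        apply Finset.prod_congr rfl
        intro i hi
        rw [Finset.mem_filter] at hi
        rw [hi.2]; simp
      · apply Finset.prod_congr rfl
        intro i hi
        rw [Finset.mem_filter] at hi
        simp [hℓb i hi.2]
    simp_rw [h1]
    rw [← Finset.sum_mul]
    have h2 : ∑ u : F, (χ ^ E) (g.eval b0 + u * ℓ.eval b0) = ∑ v : F, (χ ^ E) v := by
      apply Fintype.sum_bijective (fun u => g.eval b0 + u * ℓ.eval b0)
      · exact ((Equiv.mulRight₀ _ hℓ0).trans (Equiv.addLeft (g.eval b0))).bijective
      · intro u; rfl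
    rw [h2, MulChar.sum_eq_zero_of_ne_one hχE, zero_mul]
  simp_rw [hshift] at hz
  rw [Finset.sum_const, nsmul_eq_mul, mul_eq_zero] at hz
  rcases hz with hz | hz
  · have : Fintype.card F ≠ 0 := Fintype.card_ne_zero
    exact absurd (by exact_mod_cast hz) this
  · exact hz

/-- The norm-lift of a multiplicative character. -/
noncomputable def normChar (χ : MulChar F ℂ) (L : Type) [Field L] [Fintype L] [Algebra F L] :
    MulChar L ℂ where
  toFun x := χ (Algebra.norm F x)
  map_one' := by simp
  map_mul' x y := by simp
  map_nonunit' x hx := by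
    have : x = 0 := by by_contra h; exact hx (isUnit_iff_ne_zero.mpr h)
    simp [this, MulChar.map_zero]

theorem normChar_apply (χ : MulChar F ℂ) (L : Type) [Field L] [Fintype L] [Algebra F L] (x : L) :
    normChar χ L x = χ (Algebra.norm F x) := rfl

theorem orderOf_normChar (χ : MulChar F ℂ) (L : Type) [Field L] [Fintype L] [Algebra F L] :
    orderOf (normChar χ L) = orderOf χ := by
  rw [orderOf_eq_orderOf_iff]
  intro n
  rw [MulChar.eq_one_iff, MulChar.eq_one_iff]
  simp_rw [MulChar.pow_apply_coe, normChar_apply]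
  constructor
  · intro h a
    obtain ⟨x, hx⟩ := FiniteField.unitsMap_norm_surjective F L a
    have := h x
    rw [← hx]
    exact this
  · intro h a
    exact h (Units.map (Algebra.norm F) a)

theorem Lpow_charL (χ : MulChar F ℂ) {ι : Type} [Fintype ι] (b : ι → F) (e : ι → ℕ)
    (L : Type) [Field L] [Fintype L] [Algebra F L] :
    Lpow (charL χ b e) (Module.finrank F L)
      = ∑ x : L, ∏ i, normChar χ L (algebraMap F L (b i) - x) ^ e i := by
  rw [Lpow_eq_sum _ L]
  apply Finset.sum_congr rfl
  intro x _
  rw [charL_apply, ← Finset.prod_pow]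
  apply Finset.prod_congr rfl
  intro i _
  rw [normChar_apply, norm_sub_eq, map_pow, pow_right_comm]

theorem Lpow_one (χ : MulChar F ℂ) {ι : Type} [Fintype ι] (b : ι → F) (e : ι → ℕ) :
    Lpow (charL χ b e) 1 = ∑ x : F, ∏ i, χ (b i - x) ^ e i := by
  have := Lpow_charL χ b e F
  rw [Module.finrank_self] at this
  rw [this]
  simp [normChar_apply]

theorem norm_prod_neg {K : Type} [Field K] [Fintype K] (ψ : MulChar K ℂ) {ι : Type} [Fintype ι]
    (b : ι → K) (e : ι → ℕ) :
    ‖∑ x : K, ∏ i, ψ (b i - x) ^ e i‖ = ‖∑ x : K, ∏ i, ψ (x - b i) ^ e i‖ := by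
  have h : ∀ x : K, ∏ i, ψ (b i - x) ^ e i = ψ (-1) ^ (∑ i, e i) * ∏ i, ψ (x - b i) ^ e i := by
    intro x
    rw [← Finset.prod_pow_eq_pow_sum, ← Finset.prod_mul_distrib]
    apply Finset.prod_congr rfl
    intro i _
    rw [← mul_pow, ← map_mul]; congr 2; ring
  simp_rw [h]
  rw [← Finset.mul_sum, norm_mul, norm_pow, mulChar_norm_one ψ (by simp), one_pow, one_mul]

theorem Lpow_bound (χ : MulChar F ℂ) (d : ℕ) (hχ : orderOf χ = d) (hd : 2 ≤ d) {ι : Type}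
    [Fintype ι] (b : ι → F) (e : ι → ℕ) (hcop : (∑ i, e i).Coprime d) :
    ∃ c : ℝ, 0 ≤ c ∧ ∀ n : ℕ, 0 < n → ‖Lpow (charL χ b e) (2 * n)‖ ≤ c * (Fintype.card F : ℝ) ^ n := by
  refine ⟨((d * (4 * (∑ i, e i) + 4) + (∑ i, e i) + 2 * d * ((∑ i, e i) + 2) : ℕ) : ℝ),
    Nat.cast_nonneg _, ?_⟩
  intro n hn
  obtain ⟨p, hp⟩ := CharP.exists F
  obtain ⟨m, hpp, hm⟩ := FiniteField.card F p
  haveI : Fact p.Prime := ⟨hpp⟩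
  haveI : NeZero (2 * n) := ⟨by omega⟩
  let L := FiniteField.Extension F p (2 * n)
  haveI : Finite L := Module.finite_of_finite F
  letI : Fintype L := Fintype.ofFinite L
  have hfr : Module.finrank F L = 2 * n := FiniteField.finrank_extension F p (2 * n)
  haveI : CharP L p := charP_of_injective_algebraMap (algebraMap F L).injective p
  have hL : Fintype.card L = (Fintype.card F ^ n) ^ 2 := by
    rw [Module.card_eq_pow_finrank (K := F) (V := L), hfr, ← pow_mul, mul_comm]
  have h1 := Lpow_charL χ b e L
  rw [hfr] at h1
  rw [h1, norm_prod_neg]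
  let f : L[X] := ∏ i, (X - C (algebraMap F L (b i))) ^ e i
  have hf : f.Monic := monic_prod_of_monic _ _ (fun i _ => (monic_X_sub_C _).pow _)
  have hfd : f.natDegree = ∑ i, e i := by
    rw [natDegree_prod_of_monic _ _ (fun i _ => (monic_X_sub_C _).pow _)]
    simp
  have h2 := stepanov_sum (K := L) p (m * n) (Fintype.card F ^ n) d (∑ i, e i)
    (by rw [hm, ← pow_mul]) hL hd f hf hfd hcop (normChar χ L) (by rw [orderOf_normChar, hχ])
  have h3 : ∀ x : L, normChar χ L (f.eval x) = ∏ i, normChar χ L (x - algebraMap F L (b i)) ^ e i := by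
    intro x
    simp only [f, eval_prod, eval_pow, eval_sub, eval_X, eval_C, map_prod, map_pow]
  simp_rw [h3] at h2
  rw [Nat.cast_pow] at h2
  exact h2
end CharSection


section PowerSums
open Polynomial

theorem root_bound {σ : Type*} [Fintype σ] (w : σ → ℂ) (R c : ℝ) (hR : 0 < R)
    (h : ∀ n : ℕ, 0 < n → ‖∑ j, w j ^ n‖ ≤ c * R ^ n) (i : σ) : ‖w i‖ ≤ R := by
  classical
  set W := univ.image w with hW
  set P := Lagrange.basis W id (w i) with hP
  have hmem : ∀ j, w j ∈ W := fun j => Finset.mem_image_of_mem _ (Finset.mem_univ _)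
  have hPe : ∀ j, P.eval (w j) = if w j = w i then 1 else 0 := by
    intro j
    split_ifs with hj
    · rw [hj]; exact Lagrange.eval_basis_self (v := id) (Set.injOn_id _) (hmem i)
    · exact Lagrange.eval_basis_of_ne (v := id) (fun h => hj h.symm) (hmem j)
  set C' := ∑ k ∈ range (P.natDegree + 1), ‖P.coeff k‖ * (c * R ^ k) with hC'
  have key : ∀ n : ℕ, 0 < n → ‖w i‖ ^ n ≤ C' * R ^ n := by
    intro n hn
    have h1 : ∑ j, P.eval (w j) * w j ^ n
        = ∑ k ∈ range (P.natDegree + 1), P.coeff k * ∑ j, w j ^ (k + n) := by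
      simp_rw [eval_eq_sum_range, Finset.sum_mul, Finset.mul_sum]
      rw [Finset.sum_comm]
      apply Finset.sum_congr rfl; intro k _
      apply Finset.sum_congr rfl; intro j _
      rw [pow_add]; ring
    have h2 : ∑ j, P.eval (w j) * w j ^ n = ((univ.filter (fun j => w j = w i)).card : ℂ) * w i ^ n := by
      simp_rw [hPe, ite_mul, one_mul, zero_mul]
      rw [← Finset.sum_filter, Finset.sum_congr rfl (g := fun _ => w i ^ n)]
      · simp
      · intro j hj; rw [(Finset.mem_filter.mp hj).2]
    have h3 : (1 : ℝ) ≤ (univ.filter (fun j => w j = w i)).card := by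
      have : 0 < (univ.filter (fun j => w j = w i)).card :=
        Finset.card_pos.mpr ⟨i, by simp⟩
      exact_mod_cast this
    have h4 : ‖w i‖ ^ n ≤ ‖∑ j, P.eval (w j) * w j ^ n‖ := by
      rw [h2, norm_mul, norm_pow, Complex.norm_natCast]
      nlinarith [pow_nonneg (norm_nonneg (w i)) n]
    refine h4.trans ?_
    rw [h1, hC', Finset.sum_mul]
    refine (norm_sum_le _ _).trans (Finset.sum_le_sum fun k _ => ?_)
    rw [norm_mul, mul_assoc]
    refine mul_le_mul_of_nonneg_left ?_ (norm_nonneg _)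
    refine (h (k + n) (by omega)).trans (le_of_eq ?_)
    rw [pow_add]; ring
  by_contra! hlt
  obtain ⟨n, hn⟩ := pow_unbounded_of_one_lt C' ((one_lt_div hR).mpr hlt)
  have h1 : 1 < ‖w i‖ / R := (one_lt_div hR).mpr hlt
  have h2 : (‖w i‖ / R) ^ n ≤ (‖w i‖ / R) ^ (n + 1) := pow_le_pow_right₀ h1.le (by omega)
  have h3 := key (n + 1) (by omega)
  rw [div_pow _ _ (n + 1)] at h2
  have h4 : ‖w i‖ ^ (n + 1) / R ^ (n + 1) ≤ C' := by
    rw [div_le_iff₀ (pow_pos hR _)]; exact h3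
  linarith

theorem newton_roots (a S : ℕ → ℂ) (m : ℕ) (ha0 : a 0 = 1) (hav : ∀ k, m ≤ k → a k = 0)
    (hrec : ∀ n : ℕ, (n : ℂ) * a n = ∑ j ∈ Icc 1 n, S j * a (n - j)) :
    ∃ s : Multiset ℂ, s.card = m ∧ ∀ n : ℕ, 0 < n → S n = - ∑ x : s, (x : ℂ) ^ n := by
  classical
  set P : ℂ[X] := ∑ k ∈ range (m + 1), C (a (m - k)) * X ^ k with hP
  have hco : ∀ k, k ≤ m → P.coeff k = a (m - k) := by
    intro k hk
    rw [hP, finsetSum_coeff]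
    simp only [coeff_C_mul, coeff_X_pow, mul_ite, mul_one, mul_zero]
    rw [Finset.sum_ite_eq, if_pos (by simp; omega)]
  have hdeg : P.natDegree ≤ m := by
    apply natDegree_sum_le_of_forall_le
    intro k hk
    exact (natDegree_C_mul_X_pow_le _ _).trans (by simp at hk; omega)
  have hcm : P.coeff m = 1 := by rw [hco m le_rfl]; simp [ha0]
  have hmon : P.Monic := monic_of_natDegree_le_of_coeff_eq_one m hdeg hcm
  have hd : P.natDegree = m := le_antisymm hdeg (le_natDegree_of_ne_zero (by rw [hcm]; simp))
  have hsp : P.Splits := IsAlgClosed.splits P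
  have hcard : P.roots.card = m := by rw [← hsp.natDegree_eq_card_roots, hd]
  refine ⟨P.roots, hcard, ?_⟩
  set ω : P.roots → ℂ := fun x => (x : ℂ) with hω
  have he : ∀ k, MvPolynomial.aeval ω (MvPolynomial.esymm P.roots ℂ k) = (-1) ^ k * a k := by
    intro k
    rw [MvPolynomial.aeval_esymm_eq_multiset_esymm, hω, Multiset.map_univ_coe]
    by_cases hk : k ≤ m
    · have h1 := coeff_eq_esymm_roots_of_splits hsp (k := m - k) (by rw [hd]; omega)
      rw [hmon.leadingCoeff, hd, hco _ (by omega), one_mul, Nat.sub_sub_self hk] at h1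
      rw [h1, ← mul_assoc, ← mul_pow]; simp
    · rw [hav k (by omega), mul_zero, Multiset.esymm, Multiset.powersetCard_eq_empty]
      · simp
      · omega
  have hp : ∀ k, MvPolynomial.aeval ω (MvPolynomial.psum P.roots ℂ k) = ∑ x : P.roots, (x : ℂ) ^ k := by
    intro k
    simp [MvPolynomial.psum, hω]
  have hN : ∀ n : ℕ, (n : ℂ) * a n = - ∑ j ∈ Icc 1 n, (∑ x : P.roots, (x : ℂ) ^ j) * a (n - j) := by
    intro n
    have h1 := congrArg (MvPolynomial.aeval ω) (MvPolynomial.mul_esymm_eq_sum P.roots ℂ n)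
    simp only [map_mul, map_natCast, map_pow, map_neg, map_one, map_sum, he, hp] at h1
    have h2 : ∑ x ∈ antidiagonal n with x.1 < n,
        (-1 : ℂ) ^ x.1 * ((-1) ^ x.1 * a x.1) * ∑ y : P.roots, (y : ℂ) ^ x.2
        = ∑ j ∈ Icc 1 n, (∑ x : P.roots, (x : ℂ) ^ j) * a (n - j) := by
      apply Finset.sum_bij' (fun x _ => x.2) (fun j _ => (n - j, j))
      · intro x hx; simp only [Finset.mem_filter, HasAntidiagonal.mem_antidiagonal, Finset.mem_Icc] at hx ⊢; omega
      · intro x hx; simp only [Finset.mem_filter, HasAntidiagonal.mem_antidiagonal, Finset.mem_Icc] at hx ⊢; omega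
      · intro x hx; simp only [Finset.mem_filter, HasAntidiagonal.mem_antidiagonal] at hx
        ext <;> simp; omega
      · intro x hx; rfl
      · intro x hx; simp only [Finset.mem_filter, HasAntidiagonal.mem_antidiagonal] at hx
        have : n - x.2 = x.1 := by omega
        rw [this, ← mul_assoc, ← mul_pow]; simp [mul_comm]
    rw [h2] at h1
    have h3 : ((-1 : ℂ) ^ n) * (-1) ^ n = 1 := by rw [← mul_pow]; simp
    have h4 : (n : ℂ) * a n = (-1) ^ n * (n * ((-1) ^ n * a n)) := by
      linear_combination (-(n : ℂ) * a n) * h3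
    rw [h4, h1, pow_succ]
    linear_combination (-∑ j ∈ Icc 1 n, (∑ x : P.roots, (x : ℂ) ^ j) * a (n - j)) * h3
  intro n
  induction n using Nat.strong_induction_on with
  | _ n ih =>
    intro hn
    have h1 := (hrec n).symm.trans (hN n)
    have hI : Icc 1 n = insert n (Icc 1 (n - 1)) := by
      ext j; simp only [Finset.mem_Icc, Finset.mem_insert]; omega
    rw [hI, Finset.sum_insert (by simp; omega), Finset.sum_insert (by simp; omega)] at h1
    have h2 : ∑ j ∈ Icc 1 (n - 1), S j * a (n - j)
        = - ∑ j ∈ Icc 1 (n - 1), (∑ x : P.roots, (x : ℂ) ^ j) * a (n - j) := by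
      rw [← Finset.sum_neg_distrib]
      apply Finset.sum_congr rfl
      intro j hj
      rw [Finset.mem_Icc] at hj
      rw [ih j (by omega) (by omega), neg_mul]
    rw [h2] at h1
    simp only [Nat.sub_self, ha0, mul_one] at h1
    linear_combination h1

theorem power_sum_bound (a S : ℕ → ℂ) (m : ℕ) (ha0 : a 0 = 1) (hav : ∀ k, m ≤ k → a k = 0)
    (hrec : ∀ n : ℕ, (n : ℂ) * a n = ∑ j ∈ Icc 1 n, S j * a (n - j)) (R c : ℝ) (hR : 0 < R)
    (hS : ∀ n : ℕ, 0 < n → ‖S (2 * n)‖ ≤ c * R ^ n) : ‖S 1‖ ≤ m * Real.sqrt R := by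
  obtain ⟨s, hs, hSn⟩ := newton_roots a S m ha0 hav hrec
  have h1 : ∀ x : s, ‖(x : ℂ) ^ 2‖ ≤ R := by
    apply root_bound (fun x : s => (x : ℂ) ^ 2) R c hR
    intro n hn
    have := hS n hn
    rw [hSn _ (by omega), norm_neg] at this
    simpa [pow_mul] using this
  rw [hSn 1 one_pos, norm_neg]
  refine (norm_sum_le _ _).trans ?_
  have h2 : ∀ x ∈ (univ : Finset s), ‖(x : ℂ) ^ 1‖ ≤ Real.sqrt R := by
    intro x _
    rw [pow_one]
    apply Real.le_sqrt_of_sq_le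
    rw [← norm_pow]; exact h1 x
  refine (Finset.sum_le_card_nsmul _ _ _ h2).trans ?_
  rw [nsmul_eq_mul, Finset.card_univ, Multiset.card_coe, hs]
end PowerSums

theorem weil {F : Type} [Field F] [Fintype F] (χ : MulChar F ℂ) (d : ℕ) (hχ : orderOf χ = d)
    (hd : 2 ≤ d) {ι : Type} [Fintype ι] (b : ι → F) (e : ι → ℕ) (hcop : (∑ i, e i).Coprime d) :
    ‖∑ x : F, ∏ i, χ (x - b i) ^ e i‖ ≤ Fintype.card ι * Real.sqrt (Fintype.card F) := by
  obtain ⟨c, _, hc⟩ := Lpow_bound χ d hχ hd b e hcop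
  rw [← norm_prod_neg, ← Lpow_one]
  exact power_sum_bound (Lcoef (charL χ b e)) (Lpow (charL χ b e)) (Fintype.card ι)
    (Lcoef_zero _) (fun k hk => Lcoef_vanish χ d hχ hd b e hcop k hk) (euler_identity _)
    (Fintype.card F) c (by exact_mod_cast Fintype.card_pos) hc


theorem mulChar_pow_order {F : Type} [Field F] [Fintype F] (χ : MulChar F ℂ) (d : ℕ)
    (hχ : orderOf χ = d) {a : F} (ha : a ≠ 0) : χ a ^ d = 1 := by
  have h := pow_orderOf_eq_one χ
  rw [hχ] at h
  have h2 := MulChar.pow_apply_coe χ d (Units.mk0 a ha)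
  rw [h, MulChar.one_apply_coe] at h2
  simpa using h2.symm

theorem mulChar_inv_eq {F : Type} [Field F] [Fintype F] (χ : MulChar F ℂ) (d : ℕ)
    (hχ : orderOf χ = d) (hd : 2 ≤ d) (a : F) : χ a⁻¹ = χ a ^ (d - 1) := by
  by_cases ha : a = 0
  · rw [ha, inv_zero, MulChar.map_zero, zero_pow (by omega)]
  · have h1 := mulChar_pow_order χ d hχ ha
    have h2 : χ a ≠ 0 := by
      intro h; rw [h, zero_pow (by omega)] at h1; exact zero_ne_one h1
    have h3 : χ a⁻¹ * χ a = 1 := by rw [← map_mul, inv_mul_cancel₀ ha, map_one]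
    apply mul_right_cancel₀ h2
    rw [h3, ← pow_succ, Nat.sub_add_cancel (by omega), h1]

theorem mulChar_conj_eq {F : Type} [Field F] [Fintype F] (χ : MulChar F ℂ) (d : ℕ)
    (hχ : orderOf χ = d) (hd : 2 ≤ d) (a : F) : (starRingEnd ℂ) (χ a) = χ a ^ (d - 1) := by
  rw [← mulChar_inv_eq χ d hχ hd, ← MulChar.inv_apply', ← MulChar.star_apply']
  rfl

theorem tuple_bound {F : Type} [Field F] [Fintype F] (χ : MulChar F ℂ) (d : ℕ)
    (hχ : orderOf χ = d) (hd : 2 ≤ d) {ι : Type} [Fintype ι] [DecidableEq ι] (t : ι → F)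
    (σ : ι → ℕ) (hσ : ∀ i, σ i ≠ 0) (i0 : ι) (hi0 : ∀ i, i ≠ i0 → t i ≠ t i0)
    (hcop : (σ i0).Coprime d) :
    ‖∑ x : F, ∏ i, χ (x + t i) ^ σ i‖ ≤ Fintype.card ι * Real.sqrt (Fintype.card F) := by
  classical
  set β : ι → F := fun i => t i - t i0 with hβ
  have hβ0 : ∀ i, i ≠ i0 → β i ≠ 0 := fun i hi => sub_ne_zero.mpr (hi0 i hi)
  let ι' := Option {i : ι // i ≠ i0}
  let b : ι' → F := fun o => o.elim 0 (fun i => -(β i.1)⁻¹)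
  let e : ι' → ℕ := fun o => o.elim ((d - 1) * ∑ i, σ i) (fun i => σ i.1)
  have hsub : ∀ {M : Type} [CommMonoid M] (f : ι → M),
      ∏ i, f i = f i0 * ∏ i : {i : ι // i ≠ i0}, f i.1 := by
    intro M _ f
    rw [← Finset.mul_prod_erase univ f (Finset.mem_univ i0)]
    congr 1
    apply Finset.prod_subtype
    intro x; simp
  have hsubs : ∑ i, σ i = σ i0 + ∑ i : {i : ι // i ≠ i0}, σ i.1 := by
    rw [← Finset.add_sum_erase univ σ (Finset.mem_univ i0)]
    congr 1
    apply Finset.sum_subtype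
    intro x; simp
  have hsum : ∑ o, e o = (d - 1) * ∑ i, σ i + ∑ i : {i : ι // i ≠ i0}, σ i.1 := by
    rw [Fintype.sum_option]; rfl
  have hadd : ∑ o, e o + σ i0 = d * ∑ i, σ i := by
    rw [hsum, add_assoc, add_comm _ (σ i0), ← hsubs]
    obtain ⟨d', rfl⟩ : ∃ d', d = d' + 1 := ⟨d - 1, by omega⟩
    simp; ring
  have hcop' : (∑ o, e o).Coprime d := by
    have h1 : Nat.gcd (∑ o, e o) d ∣ σ i0 := by
      have h2 : Nat.gcd (∑ o, e o) d ∣ ∑ o, e o + σ i0 := by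
        rw [hadd]; exact (Nat.gcd_dvd_right _ _).mul_right _
      exact (Nat.dvd_add_right (Nat.gcd_dvd_left _ _)).mp h2
    have h3 := Nat.dvd_gcd h1 (Nat.gcd_dvd_right (∑ o, e o) d)
    rw [hcop] at h3
    exact Nat.dvd_one.mp h3
  have hW := weil χ d hχ hd b e hcop'
  have hcard : Fintype.card ι' = Fintype.card ι := by
    rw [Fintype.card_option, Fintype.card_subtype_compl, Fintype.card_subtype_eq]
    have : 0 < Fintype.card ι := Fintype.card_pos_iff.mpr ⟨i0⟩
    omega
  rw [hcard] at hW
  set K : ℂ := ∏ i : {i : ι // i ≠ i0}, χ (β i.1) ^ σ i.1 with hK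
  have hKn : ‖K‖ = 1 := by
    rw [hK, norm_prod]
    apply Finset.prod_eq_one
    intro i _
    rw [norm_pow, mulChar_norm_one χ (hβ0 i.1 i.2), one_pow]
  have hsσ : (d - 1) * ∑ i, σ i ≠ 0 := by
    have h1 := hσ i0
    have : 0 < ∑ i, σ i := by rw [hsubs]; omega
    exact Nat.mul_ne_zero (by omega) (by omega)
  have hterm : ∀ z : F, ∏ i, χ ((z⁻¹ - t i0) + t i) ^ σ i = K * ∏ o, χ (z - b o) ^ e o := by
    intro z
    have hR : ∏ o, χ (z - b o) ^ e o
        = χ z ^ ((d - 1) * ∑ i, σ i) * ∏ i : {i : ι // i ≠ i0}, χ (z + (β i.1)⁻¹) ^ σ i.1 := by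
      rw [Fintype.prod_option]
      simp [b, e]
    rw [hR]
    by_cases hz : z = 0
    · rw [hz, MulChar.map_zero, zero_pow hsσ, zero_mul, mul_zero]
      apply Finset.prod_eq_zero (Finset.mem_univ i0)
      simp [hσ i0, MulChar.map_zero]
    · have h1 : ∀ i : {i : ι // i ≠ i0}, χ ((z⁻¹ - t i0) + t i.1) ^ σ i.1
          = χ z⁻¹ ^ σ i.1 * (χ (β i.1) ^ σ i.1 * χ (z + (β i.1)⁻¹) ^ σ i.1) := by
        intro i
        rw [← mul_pow, ← mul_pow, ← map_mul, ← map_mul]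
        congr 2
        have := hβ0 i.1 i.2
        field_simp
        rw [hβ]; ring
      rw [hsub]
      simp_rw [h1]
      rw [Finset.prod_mul_distrib, Finset.prod_mul_distrib, ← hK, Finset.prod_pow_eq_pow_sum]
      have h2 : χ ((z⁻¹ - t i0) + t i0) = χ z⁻¹ := by congr 1; ring
      rw [h2, ← mul_assoc, ← pow_add, ← hsubs, mulChar_inv_eq χ d hχ hd, ← pow_mul]
      ring
  have hre : ∑ x : F, ∏ i, χ (x + t i) ^ σ i = ∑ z : F, ∏ i, χ ((z⁻¹ - t i0) + t i) ^ σ i := by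
    symm
    apply Fintype.sum_bijective (fun z : F => z⁻¹ - t i0)
    · exact (((Equiv.inv F)).trans (Equiv.subRight (t i0))).bijective
    · intro z; rfl
  rw [hre]
  simp_rw [hterm]
  rw [← Finset.mul_sum, norm_mul, hKn, one_mul]
  exact hW

theorem bad_count {F : Type} [DecidableEq F] (B : Finset F) (r : ℕ) (hr : 0 < r) :
    ((Fintype.piFinset (fun _ : Fin r ⊕ Fin r => B)).filter
      (fun t => ∀ i, ∃ j, j ≠ i ∧ t j = t i)).card ≤ B.card ^ r * r ^ (2 * r) := by
  classical
  let Φ : (Fin r → F) × (Fin r ⊕ Fin r → Fin r) → (Fin r ⊕ Fin r → F) := fun x => x.1 ∘ x.2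
  have hsub : (Fintype.piFinset (fun _ : Fin r ⊕ Fin r => B)).filter
      (fun t => ∀ i, ∃ j, j ≠ i ∧ t j = t i)
      ⊆ (Fintype.piFinset (fun _ : Fin r => B) ×ˢ univ).image Φ := by
    intro t ht
    rw [Finset.mem_filter, Fintype.mem_piFinset] at ht
    obtain ⟨htB, ht2⟩ := ht
    set V := univ.image t with hV
    have hVc : V.card ≤ r := by
      have h1 : V.card * 2 ≤ (univ : Finset (Fin r ⊕ Fin r)).card := by
        rw [Finset.card_eq_sum_card_image t univ, ← hV, ← smul_eq_mul]
        apply Finset.card_nsmul_le_sum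
        intro v hv
        obtain ⟨i, _, hi⟩ := Finset.mem_image.mp hv
        obtain ⟨j, hj, hji⟩ := ht2 i
        apply Nat.succ_le_of_lt
        rw [Finset.one_lt_card]
        exact ⟨i, by simp [hi], j, by simp [hji, hi], hj.symm⟩
      rw [Finset.card_univ, Fintype.card_sum, Fintype.card_fin] at h1
      omega
    obtain ⟨em⟩ : Nonempty (V ↪ Fin r) :=
      Function.Embedding.nonempty_of_card_le (by simpa using hVc)
    have hmem : ∀ i, t i ∈ V := fun i => Finset.mem_image_of_mem _ (Finset.mem_univ _)
    haveI : Nonempty V := ⟨⟨t (Sum.inl ⟨0, hr⟩), hmem _⟩⟩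
    rw [Finset.mem_image]
    refine ⟨(fun k => (Function.invFun em k : V).1, fun i => em ⟨t i, hmem i⟩), ?_, ?_⟩
    · rw [Finset.mem_product, Fintype.mem_piFinset]
      refine ⟨fun k => ?_, Finset.mem_univ _⟩
      obtain ⟨i, _, hi⟩ := Finset.mem_image.mp (Function.invFun em k : V).2
      change ((Function.invFun em k : V) : F) ∈ B
      rw [← hi]; exact htB i
    · funext i
      simp only [Φ, Function.comp]
      rw [Function.leftInverse_invFun em.injective]
  refine (Finset.card_le_card hsub).trans (Finset.card_image_le.trans ?_)
  rw [Finset.card_product, Fintype.card_piFinset_const, Finset.card_univ]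
  simp [two_mul]

theorem moment_bound {F : Type} [Field F] [Fintype F] (χ : MulChar F ℂ) (d : ℕ)
    (hχ : orderOf χ = d) (hd : 2 ≤ d) (B : Finset F) (r : ℕ) (hr : 0 < r) :
    ∑ x : F, ‖∑ b ∈ B, χ (x + b)‖ ^ (2 * r)
      ≤ (r : ℝ) ^ (2 * r) * (B.card : ℝ) ^ r * Fintype.card F
        + 2 * r * (B.card : ℝ) ^ (2 * r) * Real.sqrt (Fintype.card F) := by
  classical
  let ι := Fin r ⊕ Fin r
  let σ : ι → ℕ := Sum.elim (fun _ => 1) (fun _ => d - 1)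
  have hσ : ∀ i, σ i ≠ 0 := by
    rintro (i | i) <;> simp [σ]; omega
  have hσc : ∀ i, (σ i).Coprime d := by
    rintro (i | i) <;> simp only [σ, Sum.elim_inl, Sum.elim_inr]
    · exact Nat.coprime_one_left d
    · exact (Nat.coprime_self_sub_right (by omega : 1 ≤ d)).mpr (by simp) |>.symm
  have hpt : ∀ x : F, ((‖∑ b ∈ B, χ (x + b)‖ ^ (2 * r) : ℝ) : ℂ)
      = ∑ t ∈ Fintype.piFinset (fun _ : ι => B), ∏ i, χ (x + t i) ^ σ i := by
    intro x
    rw [← Finset.prod_univ_sum (fun _ : ι => B) (fun i b => χ (x + b) ^ σ i), Fintype.prod_sum_type]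
    simp only [σ, Sum.elim_inl, Sum.elim_inr, pow_one, Finset.prod_const, Finset.card_univ,
      Fintype.card_fin]
    simp_rw [← mulChar_conj_eq χ d hχ hd]
    rw [← map_sum (starRingEnd ℂ), ← mul_pow, Complex.mul_conj, Complex.normSq_eq_norm_sq, pow_mul]
    push_cast; ring
  have hsum : ((∑ x : F, ‖∑ b ∈ B, χ (x + b)‖ ^ (2 * r) : ℝ) : ℂ)
      = ∑ t ∈ Fintype.piFinset (fun _ : ι => B), ∑ x : F, ∏ i, χ (x + t i) ^ σ i := by
    rw [Finset.sum_comm, Complex.ofReal_sum]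
    exact Finset.sum_congr rfl (fun x _ => hpt x)
  have hnn : 0 ≤ ∑ x : F, ‖∑ b ∈ B, χ (x + b)‖ ^ (2 * r) :=
    Finset.sum_nonneg (fun x _ => by positivity)
  have hnorm : ∑ x : F, ‖∑ b ∈ B, χ (x + b)‖ ^ (2 * r)
      = ‖∑ t ∈ Fintype.piFinset (fun _ : ι => B), ∑ x : F, ∏ i, χ (x + t i) ^ σ i‖ := by
    rw [← hsum, Complex.norm_real, Real.norm_of_nonneg hnn]
  rw [hnorm]
  refine (norm_sum_le _ _).trans ?_
  rw [← Finset.sum_filter_add_sum_filter_not _ (fun t : ι → F => ∀ i, ∃ j, j ≠ i ∧ t j = t i)]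
  apply add_le_add
  · have h1 : ∀ t ∈ (Fintype.piFinset (fun _ : ι => B)).filter
        (fun t : ι → F => ∀ i, ∃ j, j ≠ i ∧ t j = t i),
        ‖∑ x : F, ∏ i, χ (x + t i) ^ σ i‖ ≤ (Fintype.card F : ℝ) := by
      intro t _
      refine (norm_sum_le _ _).trans ?_
      have : ∀ x ∈ (univ : Finset F), ‖∏ i, χ (x + t i) ^ σ i‖ ≤ 1 := by
        intro x _
        rw [norm_prod]
        apply Finset.prod_le_one (fun i _ => norm_nonneg _)
        intro i _
        rw [norm_pow]
        exact pow_le_one₀ (norm_nonneg _) (mulChar_norm_le_one χ _)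
      refine (Finset.sum_le_card_nsmul _ _ _ this).trans ?_
      simp
    refine (Finset.sum_le_card_nsmul _ _ _ h1).trans ?_
    rw [nsmul_eq_mul]
    apply mul_le_mul_of_nonneg_right _ (Nat.cast_nonneg _)
    have := bad_count B r hr
    calc _ ≤ ((B.card ^ r * r ^ (2 * r) : ℕ) : ℝ) := by exact_mod_cast this
      _ = _ := by push_cast; ring
  · have h1 : ∀ t ∈ (Fintype.piFinset (fun _ : ι => B)).filter
        (fun t : ι → F => ¬ ∀ i, ∃ j, j ≠ i ∧ t j = t i),
        ‖∑ x : F, ∏ i, χ (x + t i) ^ σ i‖ ≤ 2 * r * Real.sqrt (Fintype.card F) := by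
      intro t ht
      have ht2 := (Finset.mem_filter.mp ht).2
      push Not at ht2
      obtain ⟨i0, hi0⟩ := ht2
      have := tuple_bound χ d hχ hd t σ hσ i0 hi0 (hσc i0)
      have hc : (Fintype.card ι : ℝ) = 2 * r := by
        simp [ι, two_mul]
      rwa [hc] at this
    refine (Finset.sum_le_card_nsmul _ _ _ h1).trans ?_
    rw [nsmul_eq_mul]
    have h2 : ((((Fintype.piFinset (fun _ : ι => B)).filter
        (fun t : ι → F => ¬ ∀ i, ∃ j, j ≠ i ∧ t j = t i)).card : ℕ) : ℝ) ≤ (B.card : ℝ) ^ (2 * r) := by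
      have h3 := Finset.card_filter_le (Fintype.piFinset (fun _ : ι => B))
        (fun t : ι → F => ¬ ∀ i, ∃ j, j ≠ i ∧ t j = t i)
      rw [Fintype.card_piFinset, Finset.prod_const, Finset.card_univ] at h3
      have h4 : Fintype.card ι = 2 * r := by simp [ι, two_mul]
      rw [h4] at h3
      exact_mod_cast h3
    calc _ ≤ (B.card : ℝ) ^ (2 * r) * (2 * r * Real.sqrt (Fintype.card F)) :=
          mul_le_mul_of_nonneg_right h2 (by positivity)
      _ = _ := by ring

theorem holder_bound {F : Type} [Field F] [Fintype F] (χ : MulChar F ℂ) (hχ : χ ≠ 1)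
    (A B : Finset F) (r : ℕ) (hr : 0 < r) :
    ‖∑ a ∈ A, ∑ b ∈ B, χ (a + b)‖ ^ (2 * r)
      ≤ (A.card : ℝ) ^ (2 * r - 1) * ((r : ℝ) ^ (2 * r) * (B.card : ℝ) ^ r * Fintype.card F
        + 2 * r * (B.card : ℝ) ^ (2 * r) * Real.sqrt (Fintype.card F)) := by
  classical
  have hd : 2 ≤ orderOf χ := by
    have h1 := MulChar.orderOf_pos χ
    have h2 : orderOf χ ≠ 1 := fun h => hχ (orderOf_eq_one_iff.mp h)
    omega
  have hm := moment_bound χ _ rfl hd B r hr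
  have h1 : ‖∑ a ∈ A, ∑ b ∈ B, χ (a + b)‖ ^ (2 * r)
      ≤ (∑ a ∈ A, ‖∑ b ∈ B, χ (a + b)‖) ^ (2 * r) :=
    pow_le_pow_left₀ (norm_nonneg _) (norm_sum_le _ _) _
  have h2 := pow_sum_div_card_le_sum_pow (s := A) (f := fun a => ‖∑ b ∈ B, χ (a + b)‖)
    (fun a _ => norm_nonneg _) (2 * r - 1)
  rw [Nat.sub_add_cancel (by omega)] at h2
  have h3 : ∑ a ∈ A, ‖∑ b ∈ B, χ (a + b)‖ ^ (2 * r)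
      ≤ ∑ x : F, ‖∑ b ∈ B, χ (x + b)‖ ^ (2 * r) :=
    Finset.sum_le_sum_of_subset_of_nonneg (Finset.subset_univ A) (fun x _ _ => by positivity)
  rcases Finset.eq_empty_or_nonempty A with hA | hA
  · subst hA
    simp only [Finset.sum_empty, norm_zero]
    rw [zero_pow (by omega)]
    positivity
  · have hA' : (0 : ℝ) < A.card := by exact_mod_cast hA.card_pos
    rw [div_le_iff₀ (by positivity)] at h2
    refine h1.trans (h2.trans ?_)
    rw [mul_comm]
    exact mul_le_mul_of_nonneg_left (h3.trans hm) (by positivity)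


theorem mulChar_conj_inv {F : Type} [Field F] [Fintype F] (χ : MulChar F ℂ) (a : F) :
    (starRingEnd ℂ) (χ a) = χ a⁻¹ := by
  rw [← MulChar.inv_apply', ← MulChar.star_apply']
  rfl

theorem mulChar_orth {F : Type} [Field F] [Fintype F] [DecidableEq F] [Fintype (MulChar F ℂ)]
    (u v : F) : ∑ χ : MulChar F ℂ, χ u * (starRingEnd ℂ) (χ v)
      = if u = v ∧ u ≠ 0 then ((Fintype.card F : ℂ) - 1) else 0 := by
  by_cases hu : u = 0
  · simp [hu, MulChar.map_zero]
  by_cases hv : v = 0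
  · simp [hv, MulChar.map_zero]
  simp_rw [mulChar_conj_inv, ← map_mul]
  split_ifs with h
  · rw [← h.1, mul_inv_cancel₀ hu]
    simp only [map_one, Finset.sum_const, Finset.card_univ, nsmul_eq_mul, mul_one]
    have h1 := MulChar.card_eq_card_units_of_hasEnoughRootsOfUnity F ℂ
    rw [Nat.card_eq_fintype_card, Nat.card_eq_fintype_card, Fintype.card_units] at h1
    rw [h1, Nat.cast_sub Fintype.card_pos]; simp
  · have hne : u * v⁻¹ ≠ 1 := by
      intro h2
      apply h
      refine ⟨?_, hu⟩
      rw [← div_eq_mul_inv, div_eq_one_iff_eq hv] at h2; exact h2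
    obtain ⟨χ0, hχ0⟩ := MulChar.exists_apply_ne_one_of_hasEnoughRootsOfUnity F ℂ hne
    have h3 : χ0 (u * v⁻¹) * ∑ χ : MulChar F ℂ, χ (u * v⁻¹) = ∑ χ : MulChar F ℂ, χ (u * v⁻¹) := by
      rw [Finset.mul_sum]
      apply Fintype.sum_bijective (fun χ => χ0 * χ) (Group.mulLeft_bijective χ0)
      intro χ; rw [MulChar.mul_apply]
    have h4 : (χ0 (u * v⁻¹) - 1) * ∑ χ : MulChar F ℂ, χ (u * v⁻¹) = 0 := by
      linear_combination h3
    rcases mul_eq_zero.mp h4 with h5 | h5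
    · exact absurd (sub_eq_zero.mp h5) hχ0
    · exact h5

theorem mulChar_parseval {F : Type} [Field F] [Fintype F] [Fintype (MulChar F ℂ)]
    (C : Finset F) : ∑ χ : MulChar F ℂ, ‖∑ c ∈ C, χ c‖ ^ 2 ≤ ((Fintype.card F : ℝ) - 1) * C.card := by
  classical
  have h1 : ((∑ χ : MulChar F ℂ, ‖∑ c ∈ C, χ c‖ ^ 2 : ℝ) : ℂ)
      = ((((Fintype.card F : ℝ) - 1) * (C.filter (fun c => c ≠ 0)).card : ℝ) : ℂ) := by
    push_cast
    have h2 : ∀ χ : MulChar F ℂ, (‖∑ c ∈ C, χ c‖ : ℂ) ^ 2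
        = ∑ c ∈ C, ∑ c' ∈ C, χ c * (starRingEnd ℂ) (χ c') := by
      intro χ
      rw [← Complex.mul_conj', map_sum, Finset.sum_mul_sum]
    simp_rw [h2]
    rw [Finset.sum_comm]
    simp_rw [Finset.sum_comm (s := univ) (t := C), mulChar_orth]
    rw [Finset.card_filter]
    push_cast
    rw [Finset.mul_sum]
    apply Finset.sum_congr rfl
    intro c hc
    by_cases h0 : c = 0
    · simp [h0]
    · simp [h0, hc]
  have h3 : ∑ χ : MulChar F ℂ, ‖∑ c ∈ C, χ c‖ ^ 2
      = ((Fintype.card F : ℝ) - 1) * (C.filter (fun c => c ≠ 0)).card := by exact_mod_cast h1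
  rw [h3]
  have h4 : (1 : ℝ) ≤ Fintype.card F := by exact_mod_cast Fintype.card_pos
  apply mul_le_mul_of_nonneg_left _ (by linarith)
  exact_mod_cast Finset.card_filter_le _ _

theorem count_nonzero {F : Type} [Field F] [Fintype F] [DecidableEq F] [Fintype (MulChar F ℂ)]
    (A B C D : Finset F) :
    ((Fintype.card F : ℂ) - 1) * (((A ×ˢ B ×ˢ C ×ˢ D).filter
      (fun x => x.1 + x.2.1 = x.2.2.1 * x.2.2.2 ∧ x.1 + x.2.1 ≠ 0)).card : ℂ)
    = ∑ χ : MulChar F ℂ, (∑ a ∈ A, ∑ b ∈ B, χ (a + b)) *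
        (starRingEnd ℂ) ((∑ c ∈ C, χ c) * (∑ d ∈ D, χ d)) := by
  have h1 : ∀ χ : MulChar F ℂ, (∑ a ∈ A, ∑ b ∈ B, χ (a + b)) *
        (starRingEnd ℂ) ((∑ c ∈ C, χ c) * (∑ d ∈ D, χ d))
      = ∑ x ∈ A ×ˢ B ×ˢ C ×ˢ D, χ (x.1 + x.2.1) * (starRingEnd ℂ) (χ (x.2.2.1 * x.2.2.2)) := by
    intro χ
    rw [Finset.sum_mul_sum, map_sum, Finset.sum_product, Finset.sum_mul]
    apply Finset.sum_congr rfl; intro a _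
    rw [Finset.sum_product, Finset.sum_mul]
    apply Finset.sum_congr rfl; intro b _
    rw [Finset.sum_product, Finset.mul_sum]
    apply Finset.sum_congr rfl; intro c _
    rw [map_sum, Finset.mul_sum]
    simp_rw [map_mul]
  simp_rw [h1]
  rw [Finset.sum_comm]
  simp_rw [mulChar_orth]
  rw [Finset.card_filter]
  push_cast
  rw [Finset.mul_sum]
  apply Finset.sum_congr rfl
  intro x _
  split_ifs <;> simp

theorem sum_one_char {F : Type} [Field F] [Fintype F] [DecidableEq F] (C : Finset F) :
    ∑ c ∈ C, (1 : MulChar F ℂ) c = ((C.filter (fun c => c ≠ 0)).card : ℂ) := by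
  rw [Finset.card_filter]
  push_cast
  apply Finset.sum_congr rfl
  intro c _
  split_ifs with h
  · exact MulChar.one_apply (isUnit_iff_ne_zero.mpr h)
  · push Not at h; rw [h, MulChar.map_zero]

theorem sum_one_char2 {F : Type} [Field F] [Fintype F] [DecidableEq F] (A B : Finset F) :
    ∑ a ∈ A, ∑ b ∈ B, (1 : MulChar F ℂ) (a + b)
      = (((A ×ˢ B).filter (fun x => x.1 + x.2 ≠ 0)).card : ℂ) := by
  rw [Finset.card_filter, Finset.sum_product]
  push_cast
  apply Finset.sum_congr rfl
  intro a _
  apply Finset.sum_congr rfl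
  intro b _
  split_ifs with h
  · exact MulChar.one_apply (isUnit_iff_ne_zero.mpr h)
  · push Not at h; rw [h, MulChar.map_zero]

theorem count_error {F : Type} [Field F] [Fintype F] [DecidableEq F]
    (A B C D : Finset F) (M : ℝ)
    (hM : ∀ χ : MulChar F ℂ, χ ≠ 1 → ‖∑ a ∈ A, ∑ b ∈ B, χ (a + b)‖ ≤ M) (hM0 : 0 ≤ M) :
    |((Fintype.card F : ℝ) - 1) * (((A ×ˢ B ×ˢ C ×ˢ D).filter
      (fun x => x.1 + x.2.1 = x.2.2.1 * x.2.2.2 ∧ x.1 + x.2.1 ≠ 0)).card : ℝ)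
      - (((A ×ˢ B).filter (fun x => x.1 + x.2 ≠ 0)).card : ℝ) *
        ((C.filter (fun c => c ≠ 0)).card * (D.filter (fun c => c ≠ 0)).card)|
    ≤ M * (((Fintype.card F : ℝ) - 1) * Real.sqrt (C.card * D.card)) := by
  classical
  letI : Fintype (MulChar F ℂ) := Fintype.ofFinite _
  have h0 := count_nonzero A B C D
  rw [← Finset.add_sum_erase univ _ (Finset.mem_univ (1 : MulChar F ℂ)), sum_one_char,
    sum_one_char, sum_one_char2] at h0
  have hq : (1 : ℝ) ≤ Fintype.card F := by exact_mod_cast Fintype.card_pos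
  have h1 : ((((Fintype.card F : ℝ) - 1) * (((A ×ˢ B ×ˢ C ×ˢ D).filter
      (fun x => x.1 + x.2.1 = x.2.2.1 * x.2.2.2 ∧ x.1 + x.2.1 ≠ 0)).card : ℝ)
      - (((A ×ˢ B).filter (fun x => x.1 + x.2 ≠ 0)).card : ℝ) *
        ((C.filter (fun c => c ≠ 0)).card * (D.filter (fun c => c ≠ 0)).card) : ℝ) : ℂ)
      = ∑ χ ∈ univ.erase (1 : MulChar F ℂ), (∑ a ∈ A, ∑ b ∈ B, χ (a + b)) *
        (starRingEnd ℂ) ((∑ c ∈ C, χ c) * (∑ d ∈ D, χ d)) := by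
    push_cast
    rw [h0]
    simp
  rw [← Real.norm_eq_abs, ← Complex.norm_real, h1]
  refine (norm_sum_le _ _).trans ?_
  have h2 : ∑ χ ∈ univ.erase (1 : MulChar F ℂ), ‖(∑ a ∈ A, ∑ b ∈ B, χ (a + b)) *
        (starRingEnd ℂ) ((∑ c ∈ C, χ c) * (∑ d ∈ D, χ d))‖
      ≤ ∑ χ ∈ univ.erase (1 : MulChar F ℂ), M * (‖∑ c ∈ C, χ c‖ * ‖∑ d ∈ D, χ d‖) := by
    apply Finset.sum_le_sum
    intro χ hχ
    rw [norm_mul, RCLike.norm_conj, norm_mul]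
    exact mul_le_mul_of_nonneg_right (hM χ (Finset.ne_of_mem_erase hχ)) (by positivity)
  refine h2.trans ?_
  rw [← Finset.mul_sum]
  apply mul_le_mul_of_nonneg_left _ hM0
  have h3 : ∑ χ ∈ univ.erase (1 : MulChar F ℂ), ‖∑ c ∈ C, χ c‖ * ‖∑ d ∈ D, χ d‖
      ≤ ∑ χ : MulChar F ℂ, ‖∑ c ∈ C, χ c‖ * ‖∑ d ∈ D, χ d‖ :=
    Finset.sum_le_sum_of_subset_of_nonneg (Finset.erase_subset _ _) (fun _ _ _ => by positivity)
  refine h3.trans ((Real.sum_mul_le_sqrt_mul_sqrt _ _ _).trans ?_)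
  rw [← Real.sqrt_mul (Finset.sum_nonneg fun _ _ => by positivity)]
  apply Real.sqrt_le_iff.mpr
  constructor
  · have : 0 ≤ (Fintype.card F : ℝ) - 1 := by linarith
    positivity
  · rw [mul_pow, Real.sq_sqrt (by positivity)]
    calc _ ≤ (((Fintype.card F : ℝ) - 1) * C.card) * (((Fintype.card F : ℝ) - 1) * D.card) :=
          mul_le_mul (mulChar_parseval C) (mulChar_parseval D)
            (Finset.sum_nonneg fun _ _ => by positivity) (mul_nonneg (by linarith) (by positivity))
      _ = _ := by ring

theorem count_zero {F : Type} [Field F] [Fintype F] [DecidableEq F] (A B C D : Finset F) :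
    ((A ×ˢ B ×ˢ C ×ˢ D).filter
      (fun x => x.1 + x.2.1 = x.2.2.1 * x.2.2.2 ∧ ¬ x.1 + x.2.1 ≠ 0)).card
      ≤ B.card * (C.card + D.card) := by
  let Φ : F × F × F → F × F × F × F := fun y => (-y.1, y.1, y.2.1, y.2.2)
  have hsub : (A ×ˢ B ×ˢ C ×ˢ D).filter
      (fun x => x.1 + x.2.1 = x.2.2.1 * x.2.2.2 ∧ ¬ x.1 + x.2.1 ≠ 0)
      ⊆ (B ×ˢ ((C ×ˢ {0}) ∪ ({0} ×ˢ D))).image Φ := by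
    intro x hx
    simp only [Finset.mem_filter, Finset.mem_product, not_not] at hx
    obtain ⟨⟨ha, hb, hc, hd⟩, h1, h2⟩ := hx
    rw [h2] at h1
    rw [Finset.mem_image]
    refine ⟨(x.2.1, x.2.2.1, x.2.2.2), ?_, ?_⟩
    · simp only [Finset.mem_product, Finset.mem_union, Finset.mem_singleton]
      refine ⟨hb, ?_⟩
      rcases mul_eq_zero.mp h1.symm with h | h
      · exact Or.inr ⟨h, hd⟩
      · exact Or.inl ⟨hc, h⟩
    · have : -x.2.1 = x.1 := by linear_combination -h2
      simp [Φ, this]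
  refine (Finset.card_le_card hsub).trans (Finset.card_image_le.trans ?_)
  rw [Finset.card_product]
  apply Nat.mul_le_mul_left
  refine (Finset.card_union_le _ _).trans ?_
  simp

theorem count_pairs {F : Type} [Field F] [Fintype F] [DecidableEq F] (A B : Finset F) :
    A.card * B.card ≤ ((A ×ˢ B).filter (fun x => x.1 + x.2 ≠ 0)).card + B.card := by
  have h1 := Finset.card_filter_add_card_filter_not (s := A ×ˢ B) (fun x => x.1 + x.2 ≠ 0)
  rw [Finset.card_product] at h1
  rw [← h1]
  apply Nat.add_le_add_left
  have hsub : (A ×ˢ B).filter (fun x => ¬ x.1 + x.2 ≠ 0) ⊆ B.image (fun b => (-b, b)) := by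
    intro x hx
    simp only [Finset.mem_filter, Finset.mem_product, not_not] at hx
    rw [Finset.mem_image]
    refine ⟨x.2, hx.1.2, ?_⟩
    have : -x.2 = x.1 := by linear_combination -hx.2
    simp [this]
  exact (Finset.card_le_card hsub).trans Finset.card_image_le

theorem count_ne_zero {F : Type} [Field F] [Fintype F] [DecidableEq F] (C : Finset F) :
    C.card ≤ (C.filter (fun c => c ≠ 0)).card + 1 := by
  have h1 := Finset.card_filter_add_card_filter_not (s := C) (fun c => c ≠ 0)
  rw [← h1]
  apply Nat.add_le_add_left
  apply Finset.card_le_one.mpr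
  intro a ha b hb
  simp only [Finset.mem_filter, not_not] at ha hb
  rw [ha.2, hb.2]


theorem S_bound {F : Type} [Field F] [Fintype F] (ε : ℝ) (r : ℕ) (hr : 0 < r)
    (hrε : 1 / 2 ≤ (r : ℝ) * ε) (A B : Finset F)
    (hA : (A.card : ℝ) ≥ (Fintype.card F : ℝ) ^ ((1 : ℝ) / 2 + ε))
    (hB : (B.card : ℝ) ≥ (Fintype.card F : ℝ) ^ ε) (χ : MulChar F ℂ) (hχ : χ ≠ 1) :
    ‖∑ a ∈ A, ∑ b ∈ B, χ (a + b)‖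
      ≤ ((r : ℝ) ^ (2 * r) + 2 * r) * (A.card * B.card) *
        (Fintype.card F : ℝ) ^ (-(ε / (2 * r))) := by
  have h := holder_bound χ hχ A B r hr
  set q : ℝ := (Fintype.card F : ℝ) with hq
  have hq1 : 1 < q := by rw [hq]; exact_mod_cast Fintype.one_lt_card
  have hq0 : 0 < q := by linarith
  have hr1 : (1 : ℝ) ≤ r := by exact_mod_cast hr
  set α : ℝ := (A.card : ℝ)
  set β : ℝ := (B.card : ℝ)
  have hα : 0 < α := lt_of_lt_of_le (Real.rpow_pos_of_pos hq0 _) hA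
  have hβ : 0 < β := lt_of_lt_of_le (Real.rpow_pos_of_pos hq0 _) hB
  set K0 : ℝ := (r : ℝ) ^ (2 * r) + 2 * r with hK0
  have hK1 : 1 ≤ K0 := by
    have : (0 : ℝ) ≤ (r : ℝ) ^ (2 * r) := by positivity
    rw [hK0]; linarith
  have hsq : Real.sqrt q = q ^ ((1 : ℝ) / 2) := Real.sqrt_eq_rpow q
  have h1 : q ≤ β ^ r * Real.sqrt q := by
    have h2 : q ^ ((1 : ℝ) / 2) ≤ β ^ r := by
      calc q ^ ((1 : ℝ) / 2) ≤ q ^ (ε * r) :=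
            Real.rpow_le_rpow_of_exponent_le hq1.le (by linarith)
        _ = (q ^ ε) ^ r := by rw [Real.rpow_mul hq0.le, Real.rpow_natCast]
        _ ≤ β ^ r := pow_le_pow_left₀ (Real.rpow_nonneg hq0.le _) hB r
    rw [← hsq] at h2
    calc q = Real.sqrt q * Real.sqrt q := (Real.mul_self_sqrt hq0.le).symm
      _ ≤ _ := mul_le_mul_of_nonneg_right h2 (Real.sqrt_nonneg q)
  have h3 : (r : ℝ) ^ (2 * r) * β ^ r * q + 2 * r * β ^ (2 * r) * Real.sqrt q
      ≤ K0 * β ^ (2 * r) * Real.sqrt q := by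
    have h4 : (r : ℝ) ^ (2 * r) * β ^ r * q ≤ (r : ℝ) ^ (2 * r) * β ^ r * (β ^ r * Real.sqrt q) :=
      mul_le_mul_of_nonneg_left h1 (by positivity)
    have h5 : β ^ (2 * r) = β ^ r * β ^ r := by rw [two_mul, pow_add]
    rw [h5] at *
    rw [hK0]
    linarith
  have h6 : Real.sqrt q ≤ α * q ^ (-ε) := by
    calc Real.sqrt q = q ^ ((1 : ℝ) / 2 + ε) * q ^ (-ε) := by
          rw [hsq, ← Real.rpow_add hq0]; congr 1; ring
      _ ≤ _ := mul_le_mul_of_nonneg_right hA (Real.rpow_nonneg hq0.le _)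
  have h7 : ‖∑ a ∈ A, ∑ b ∈ B, χ (a + b)‖ ^ (2 * r)
      ≤ (K0 * (α * β) * q ^ (-(ε / (2 * r)))) ^ (2 * r) := by
    refine h.trans ?_
    have hpow : (q ^ (-(ε / (2 * r)))) ^ (2 * r) = q ^ (-ε) := by
      rw [← Real.rpow_natCast, ← Real.rpow_mul hq0.le]
      congr 1
      push_cast
      field_simp
    have hα2 : α ^ (2 * r) = α ^ (2 * r - 1) * α := by
      rw [← pow_succ, Nat.sub_add_cancel (by omega)]
    rw [mul_pow, mul_pow, mul_pow, hpow, hα2]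
    have hK2 : K0 ≤ K0 ^ (2 * r) := le_self_pow₀ hK1 (by omega)
    have hqε : 0 ≤ q ^ (-ε) := Real.rpow_nonneg hq0.le _
    calc _ ≤ α ^ (2 * r - 1) * (K0 * β ^ (2 * r) * Real.sqrt q) :=
          mul_le_mul_of_nonneg_left h3 (by positivity)
      _ ≤ α ^ (2 * r - 1) * (K0 * β ^ (2 * r) * (α * q ^ (-ε))) := by gcongr
      _ ≤ α ^ (2 * r - 1) * (K0 ^ (2 * r) * β ^ (2 * r) * (α * q ^ (-ε))) := by gcongr
      _ = _ := by ring
  have hqn : 0 ≤ q ^ (-(ε / (2 * r))) := Real.rpow_nonneg hq0.le _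
  exact le_of_pow_le_pow_left₀ (by omega) (by positivity) h7

theorem main_term_bound (q α β γ κ s c d η : ℝ) (hq : 2 ≤ q) (hα : 1 ≤ α) (hβ : 0 ≤ β)
    (hγ : 1 ≤ γ) (hκ : 1 ≤ κ) (hs0 : α * β - β ≤ s) (hs1 : s ≤ α * β)
    (hc0 : γ - 1 ≤ c) (hc1 : c ≤ γ) (hd0 : κ - 1 ≤ d) (hd1 : d ≤ κ)
    (hηq : 1 ≤ η * q) (hηα : 1 ≤ η * α) (hηγ : 1 ≤ η * γ) (hηκ : 1 ≤ η * κ) :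
    |s * (c * d) / (q - 1) - α * β * γ * κ / q| ≤ 3 * η * (α * β * γ * κ / q) := by
  have hη : 0 < η := by
    by_contra! h
    nlinarith
  have hs : 0 ≤ s := by nlinarith
  have hc : 0 ≤ c := by linarith
  have hd : 0 ≤ d := by linarith
  have hP : 0 ≤ α * β * γ * κ := by positivity
  have hup : s * (c * d) ≤ α * β * γ * κ := by
    calc s * (c * d) ≤ (α * β) * (γ * κ) := by gcongr
      _ = _ := by ring
  have hlow : α * β * γ * κ - (β * γ * κ + α * β * κ + α * β * γ) ≤ s * (c * d) := by
    have h1 : (γ - 1) * (κ - 1) ≤ c * d :=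
      mul_le_mul hc0 hd0 (by linarith) hc
    have h2 : (α * β - β) * ((γ - 1) * (κ - 1)) ≤ s * (c * d) :=
      mul_le_mul hs0 h1 (mul_nonneg (by linarith) (by linarith)) hs
    refine le_trans ?_ h2
    have e1 : 0 ≤ β * (α - 1) := mul_nonneg hβ (by linarith)
    have e2 : 0 ≤ β * (κ + γ - 1) := mul_nonneg hβ (by linarith)
    nlinarith
  have hq0 : 0 < q := by linarith
  have hq1 : 0 < q - 1 := by linarith
  rw [abs_le]
  constructor
  · have h1 : s * (c * d) / q ≤ s * (c * d) / (q - 1) :=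
      div_le_div_of_nonneg_left (by positivity) hq1 (by linarith)
    have h2 : α * β * γ * κ / q - 3 * η * (α * β * γ * κ / q) ≤ s * (c * d) / q := by
      have : α * β * γ * κ / q - 3 * η * (α * β * γ * κ / q)
        = (α * β * γ * κ - 3 * η * (α * β * γ * κ)) / q := by ring
      rw [this]
      apply div_le_div_of_nonneg_right _ hq0.le
      refine le_trans ?_ hlow
      have e1 : β * γ * κ * 1 ≤ β * γ * κ * (η * α) := mul_le_mul_of_nonneg_left hηα (by positivity)
      have e2 : α * β * κ * 1 ≤ α * β * κ * (η * γ) := mul_le_mul_of_nonneg_left hηγ (by positivity)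
      have e3 : α * β * γ * 1 ≤ α * β * γ * (η * κ) := mul_le_mul_of_nonneg_left hηκ (by positivity)
      linarith
    linarith
  · have h1 : s * (c * d) / (q - 1) ≤ α * β * γ * κ / (q - 1) :=
      div_le_div_of_nonneg_right hup hq1.le
    have h2 : α * β * γ * κ / (q - 1) ≤ (1 + 3 * η) * (α * β * γ * κ / q) := by
      rw [← mul_div_assoc, div_le_div_iff₀ hq1 hq0]
      have : q ≤ (1 + 3 * η) * (q - 1) := by nlinarith
      calc α * β * γ * κ * q ≤ α * β * γ * κ * ((1 + 3 * η) * (q - 1)) :=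
            mul_le_mul_of_nonneg_left this hP
        _ = _ := by ring
    linarith


/-- Theorem 1 (second part): for every `ε > 0` there exists `δ > 0` such that for all
sufficiently large finite fields `F` with `q` elements and all sets `A, B, C, D ⊆ F`
with `|A| ≥ q^{1/2+ε}`, `|B| ≥ q^ε` and `|C||D| ≥ q^{2-δ}`, the number `T` of solutions
of `a + b = cd` in `A×B×C×D` satisfies `T = (|A||B||C||D|/q)(1 + O(q^{-δ}))`. -/
theorem asymptotic_a_add_b_eq_cd (ε : ℝ) (hε : 0 < ε) :
    ∃ δ : ℝ, 0 < δ ∧ ∃ K : ℝ, 0 < K ∧ ∃ Q : ℕ,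
      ∀ (F : Type) [Field F] [Fintype F] [DecidableEq F],
        Q ≤ Fintype.card F →
        ∀ (A B C D : Finset F),
          (A.card : ℝ) ≥ (Fintype.card F : ℝ) ^ ((1 : ℝ) / 2 + ε) →
          (B.card : ℝ) ≥ (Fintype.card F : ℝ) ^ (ε : ℝ) →
          (C.card * D.card : ℝ) ≥ (Fintype.card F : ℝ) ^ ((2 : ℝ) - δ) →
          abs ((((A ×ˢ B ×ˢ C ×ˢ D).filter
              (fun x => x.1 + x.2.1 = x.2.2.1 * x.2.2.2)).card : ℝ) -
            (A.card * B.card * C.card * D.card : ℝ) / (Fintype.card F : ℝ)) ≤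
          K * (Fintype.card F : ℝ) ^ (-δ) *
            ((A.card * B.card * C.card * D.card : ℝ) / (Fintype.card F : ℝ)) := by
  obtain ⟨r0, hr0⟩ := exists_nat_gt (1 / (2 * ε))
  set r := r0 + 1 with hrdef
  have hr : 0 < r := by omega
  have hrε : 1 / 2 ≤ (r : ℝ) * ε := by
    rw [div_lt_iff₀ (by positivity)] at hr0
    rw [hrdef]; push_cast; linarith
  have hrpos : (0 : ℝ) < r := by exact_mod_cast hr
  set δ' : ℝ := ε / (2 * r) with hδ'
  have hδ'pos : 0 < δ' := by positivity
  set K0 : ℝ := (r : ℝ) ^ (2 * r) + 2 * r with hK0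
  have hK0pos : 0 < K0 := by positivity
  set δ : ℝ := min (1 / 4) (δ' / 2) with hδ
  have hδpos : 0 < δ := lt_min (by norm_num) (by positivity)
  have hδ1 : δ ≤ 1 / 4 := min_le_left _ _
  have hδ2 : δ ≤ δ' / 2 := min_le_right _ _
  refine ⟨δ, hδpos, K0 + 5, by positivity, 0, ?_⟩
  intro F _ _ _ _ A B C D hA hB hCD
  have hS := S_bound ε r hr hrε A B hA hB
  have hE := count_error A B C D _ hS (by positivity)
  have hT0 : (((A ×ˢ B ×ˢ C ×ˢ D).filter
      (fun x => x.1 + x.2.1 = x.2.2.1 * x.2.2.2 ∧ ¬ x.1 + x.2.1 ≠ 0)).card : ℝ)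
      ≤ B.card * (C.card + D.card) := by exact_mod_cast count_zero A B C D
  have hpair : (A.card : ℝ) * B.card - B.card
      ≤ (((A ×ˢ B).filter (fun x => x.1 + x.2 ≠ 0)).card : ℝ) := by
    have : (A.card : ℝ) * B.card ≤ (((A ×ˢ B).filter (fun x => x.1 + x.2 ≠ 0)).card : ℝ) + B.card := by
      exact_mod_cast count_pairs A B
    linarith
  have hpair1 : (((A ×ˢ B).filter (fun x => x.1 + x.2 ≠ 0)).card : ℝ) ≤ (A.card : ℝ) * B.card := by
    have := Finset.card_filter_le (A ×ˢ B) (fun x => x.1 + x.2 ≠ 0)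
    rw [Finset.card_product] at this
    exact_mod_cast this
  have hne : ∀ E : Finset F, (E.card : ℝ) - 1 ≤ ((E.filter (fun c => c ≠ 0)).card : ℝ) := by
    intro E
    have : (E.card : ℝ) ≤ ((E.filter (fun c => c ≠ 0)).card : ℝ) + 1 := by
      exact_mod_cast count_ne_zero E
    linarith
  have hne1 : ∀ E : Finset F, ((E.filter (fun c => c ≠ 0)).card : ℝ) ≤ E.card := by
    intro E
    exact_mod_cast Finset.card_filter_le _ _
  have hsplit : (((A ×ˢ B ×ˢ C ×ˢ D).filter
        (fun x => x.1 + x.2.1 = x.2.2.1 * x.2.2.2)).card : ℝ)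
      = (((A ×ˢ B ×ˢ C ×ˢ D).filter
      (fun x => x.1 + x.2.1 = x.2.2.1 * x.2.2.2 ∧ x.1 + x.2.1 ≠ 0)).card : ℝ)
      + (((A ×ˢ B ×ˢ C ×ˢ D).filter
      (fun x => x.1 + x.2.1 = x.2.2.1 * x.2.2.2 ∧ ¬ x.1 + x.2.1 ≠ 0)).card : ℝ) := by
    rw [← Finset.filter_filter, ← Finset.filter_filter]
    have := Finset.card_filter_add_card_filter_not (s := (A ×ˢ B ×ˢ C ×ˢ D).filter
        (fun x => x.1 + x.2.1 = x.2.2.1 * x.2.2.2)) (fun x => x.1 + x.2.1 ≠ 0)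
    rw [← this]; push_cast; rfl
  rw [hsplit]
  have hT0nn : (0 : ℝ) ≤ (((A ×ˢ B ×ˢ C ×ˢ D).filter
      (fun x => x.1 + x.2.1 = x.2.2.1 * x.2.2.2 ∧ ¬ x.1 + x.2.1 ≠ 0)).card : ℝ) := Nat.cast_nonneg _
  have hCq : (C.card : ℝ) ≤ Fintype.card F := by exact_mod_cast Finset.card_le_univ C
  have hDq : (D.card : ℝ) ≤ Fintype.card F := by exact_mod_cast Finset.card_le_univ D
  have hCn := hne C
  have hDn := hne D
  have hCn1 := hne1 C
  have hDn1 := hne1 D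
  have hq2 : (2 : ℝ) ≤ Fintype.card F := by exact_mod_cast Fintype.one_lt_card (α := F)
  generalize (((A ×ˢ B ×ˢ C ×ˢ D).filter
      (fun x => x.1 + x.2.1 = x.2.2.1 * x.2.2.2 ∧ ¬ x.1 + x.2.1 ≠ 0)).card : ℝ) = T0 at *
  generalize (((A ×ˢ B ×ˢ C ×ˢ D).filter
      (fun x => x.1 + x.2.1 = x.2.2.1 * x.2.2.2 ∧ x.1 + x.2.1 ≠ 0)).card : ℝ) = T1 at *
  generalize (((A ×ˢ B).filter (fun x => x.1 + x.2 ≠ 0)).card : ℝ) = s at *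
  generalize ((C.filter (fun c => c ≠ 0)).card : ℝ) = c at *
  generalize ((D.filter (fun c => c ≠ 0)).card : ℝ) = d at *
  clear hS hsplit hne hne1
  have hβ0 : (0 : ℝ) ≤ B.card := Nat.cast_nonneg _
  have hγ0 : (0 : ℝ) ≤ C.card := Nat.cast_nonneg _
  have hκ0 : (0 : ℝ) ≤ D.card := Nat.cast_nonneg _
  generalize (A.card : ℝ) = α at *
  generalize (B.card : ℝ) = β at *
  generalize (C.card : ℝ) = γ at *
  generalize (D.card : ℝ) = κ at *
  generalize (Fintype.card F : ℝ) = q at *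
  have hq0 : 0 < q := by linarith
  have hq1 : 1 ≤ q := by linarith
  set η := q ^ (-δ) with hη
  have hηpos : 0 < η := Real.rpow_pos_of_pos hq0 _
  have hmono : ∀ {x y : ℝ}, x ≤ y → q ^ x ≤ q ^ y := fun h =>
    Real.rpow_le_rpow_of_exponent_le hq1 h
  have hone : ∀ {x : ℝ}, 0 ≤ x → 1 ≤ q ^ x := fun h => Real.one_le_rpow hq1 h
  -- lower bounds for the sizes
  have hαl : q ^ ((1 : ℝ) / 2) ≤ α := (hmono (by linarith)).trans hA
  have hlow : ∀ x y : ℝ, 0 ≤ x → y ≤ q → q ^ (2 - δ) ≤ x * y → q ^ (1 - δ) ≤ x := by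
    intro x y hx hy hxy
    have h1 : q ^ (2 - δ) = q ^ (1 - δ) * q := by
      rw [← Real.rpow_add_one hq0.ne']; congr 1; ring
    rw [h1] at hxy
    have h2 : x * y ≤ x * q := mul_le_mul_of_nonneg_left hy hx
    exact le_of_mul_le_mul_right (hxy.trans h2) hq0
  have hγl : q ^ (1 - δ) ≤ γ := hlow γ κ hγ0 hDq hCD
  have hκl : q ^ (1 - δ) ≤ κ := hlow κ γ hκ0 hCq (by rw [mul_comm]; exact hCD)
  have hα1 : 1 ≤ α := (hone (by norm_num)).trans hαl
  have hγ1 : 1 ≤ γ := (hone (by linarith)).trans hγl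
  have hκ1 : 1 ≤ κ := (hone (by linarith)).trans hκl
  have hηmul : ∀ x y : ℝ, δ ≤ y → q ^ y ≤ x → 1 ≤ η * x := by
    intro x y hy hx
    calc 1 ≤ q ^ (-δ + y) := hone (by linarith)
      _ = η * q ^ y := by rw [hη, Real.rpow_add hq0]
      _ ≤ η * x := mul_le_mul_of_nonneg_left hx hηpos.le
  have hmain := main_term_bound q α β γ κ s c d η hq2 hα1 hβ0 hγ1 hκ1 hpair hpair1 hCn hCn1 hDn hDn1
    (hηmul q 1 (by linarith) (by rw [Real.rpow_one])) (hηmul α _ (by linarith) hαl)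
    (hηmul γ _ (by linarith) hγl) (hηmul κ _ (by linarith) hκl)
  -- the zero solutions
  have hzero : ∀ x : ℝ, q ^ (1 - δ) ≤ x → q ≤ η * (α * x) := by
    intro x hx
    calc q = q ^ (1 : ℝ) := (Real.rpow_one q).symm
      _ ≤ q ^ (-δ + (1 / 2 + (1 - δ))) := hmono (by linarith)
      _ = η * (q ^ ((1 : ℝ) / 2) * q ^ (1 - δ)) := by rw [Real.rpow_add hq0, Real.rpow_add hq0]
      _ ≤ η * (α * x) := by
        apply mul_le_mul_of_nonneg_left _ hηpos.le
        exact mul_le_mul hαl hx (Real.rpow_nonneg hq0.le _) (by linarith)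
  have hT0' : T0 ≤ 2 * η * (α * β * γ * κ / q) := by
    refine hT0.trans ?_
    rw [← mul_div_assoc, le_div_iff₀ hq0]
    have e1 := mul_le_mul_of_nonneg_left (hzero κ hκl) (mul_nonneg hβ0 hγ0)
    have e2 := mul_le_mul_of_nonneg_left (hzero γ hγl) (mul_nonneg hβ0 hκ0)
    linarith
  -- the error from nontrivial characters
  have hq1' : 0 < q - 1 := by linarith
  have hE2 : |T1 - s * (c * d) / (q - 1)| ≤ K0 * (α * β) * q ^ (-δ') * Real.sqrt (γ * κ) := by
    have h1 : (q - 1) * T1 - s * (c * d) = (q - 1) * (T1 - s * (c * d) / (q - 1)) := by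
      field_simp
    rw [h1, abs_mul, abs_of_pos hq1'] at hE
    apply le_of_mul_le_mul_left _ hq1'
    linarith
  set w := Real.sqrt (γ * κ) with hw
  have hww : w * w = γ * κ := Real.mul_self_sqrt (by positivity)
  have hwl : q ^ (1 - δ / 2) ≤ w := by
    apply Real.le_sqrt_of_sq_le
    calc (q ^ (1 - δ / 2)) ^ 2 = q ^ (2 - δ) := by
          rw [← Real.rpow_natCast, ← Real.rpow_mul hq0.le]; congr 1; push_cast; ring
      _ ≤ _ := hCD
  have hE3 : K0 * (α * β) * q ^ (-δ') * w ≤ K0 * η * (α * β * γ * κ / q) := by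
    have h1 : q ^ (-δ') * q ≤ η * w := by
      calc q ^ (-δ') * q = q ^ (-δ' + 1) := by rw [Real.rpow_add_one hq0.ne']
        _ ≤ q ^ (-δ + (1 - δ / 2)) := hmono (by linarith)
        _ = η * q ^ (1 - δ / 2) := by rw [Real.rpow_add hq0]
        _ ≤ _ := mul_le_mul_of_nonneg_left hwl hηpos.le
    rw [← mul_div_assoc, le_div_iff₀ hq0]
    have hw0 : 0 ≤ w := Real.sqrt_nonneg _
    calc K0 * (α * β) * q ^ (-δ') * w * q = (K0 * (α * β) * w) * (q ^ (-δ') * q) := by ring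
      _ ≤ (K0 * (α * β) * w) * (η * w) := mul_le_mul_of_nonneg_left h1 (by positivity)
      _ = K0 * η * (α * β * (w * w)) := by ring
      _ = _ := by rw [hww]; ring
  have hfin : T1 + T0 - α * β * γ * κ / q
      = (T1 - s * (c * d) / (q - 1)) + (s * (c * d) / (q - 1) - α * β * γ * κ / q) + T0 := by ring
  rw [hfin]
  have e1 := abs_add_le ((T1 - s * (c * d) / (q - 1))
    + (s * (c * d) / (q - 1) - α * β * γ * κ / q)) T0
  have e2 := abs_add_le (T1 - s * (c * d) / (q - 1)) (s * (c * d) / (q - 1) - α * β * γ * κ / q)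
  rw [abs_of_nonneg hT0nn] at e1
  linarith
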